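/- arXiv:1212.3769 — 2 statements merged into one kernel-verified Lean document; each statement's English description precedes it below -/
import Mathlib

section
/- Let ψ ∈ F, β ∈ ℝ, n, p ∈ ℕ with p ≤ n. Then there is a constant C = C(ψ) (uniform in β, n, p and f) such that for every f ∈ C^ψ_{β,∞}: |ρ_{n,p}(f;0) − (−1)^s·(ψ(n)/π)·∫_{I_n} f^ψ_β(t/n)·sin(t + βπ/2)/t dt| ≤ C·ψ(n), where ρ_{n,p}(f;0) = f(0) − U^ψ_{n,p}(f;0); μ(n) = n/(η(ψ;n) − n); the set I_n equals (−n/p, −μ(n)) ∪ (μ(n), n/p) if μ(n) ≤ n/p, equals (−μ(n), −n/p) ∪ (n/p, μ(n)) if n/p < μ(n) ≤ n, and equals (−n, −n/p) ∪ (n/p, n) if μ(n) > n; s = 1 if μ(n) ≤ n/p and s = 0 if μ(n) > n/p. -/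
open MeasureTheory Real Filter Set

noncomputable section

/-- The `k`-th Fourier cosine coefficient of a `2π`-periodic function. -/
def fourierA (f : ℝ → ℝ) (k : ℕ) : ℝ := (1 / π) * ∫ t in (-π)..π, f t * Real.cos (k * t)

/-- The `k`-th Fourier sine coefficient of a `2π`-periodic function. -/
def fourierB (f : ℝ → ℝ) (k : ℕ) : ℝ := (1 / π) * ∫ t in (-π)..π, f t * Real.sin (k * t)

/-- The harmonicTerm `A_k(f;x)`. -/
def harmonicTerm (f : ℝ → ℝ) (k : ℕ) (x : ℝ) : ℝ :=
  if k = 0 then fourierA f 0 / 2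
  else fourierA f k * Real.cos (k * x) + fourierB f k * Real.sin (k * x)

/-- `2π`-periodicity. -/
def Periodic2pi (f : ℝ → ℝ) : Prop := ∀ x, f (x + 2 * π) = f x

/-- The set `S_∞`: measurable `2π`-periodic functions essentially bounded by 1. -/
def SInf (φ : ℝ → ℝ) : Prop :=
  Measurable φ ∧ Periodic2pi φ ∧ (∀ᵐ t ∂(volume : Measure ℝ), |φ t| ≤ 1)

/-- `φ` is the `(ψ,β)`-derivative of `f`: `φ ∈ S_∞` and the series
`Σ (1/ψ k)(a_k(f) cos(kx+βπ/2) + b_k(f) sin(kx+βπ/2))` is the Fourier series of `φ`. -/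
def IsPsiDeriv (ψ : ℕ → ℝ) (β : ℝ) (f φ : ℝ → ℝ) : Prop :=
  SInf φ ∧ fourierA φ 0 = 0 ∧
    ∀ k : ℕ, 1 ≤ k →
      fourierA φ k = (1 / ψ k) *
        (fourierA f k * Real.cos (β * π / 2) + fourierB f k * Real.sin (β * π / 2)) ∧
      fourierB φ k = (1 / ψ k) *
        (fourierB f k * Real.cos (β * π / 2) - fourierA f k * Real.sin (β * π / 2))

/-- The class `C^ψ_{β,∞}`. -/
def ClassC (ψ : ℕ → ℝ) (β : ℝ) (f : ℝ → ℝ) : Prop :=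
  Continuous f ∧ Periodic2pi f ∧ ∃ φ, IsPsiDeriv ψ β f φ

/-- Multipliers of the sums `U^ψ_{n,p}` (with `φ(k) = (k-n+p)/ψ(k)`). -/
def lambdaU (ψ : ℕ → ℝ) (n p k : ℕ) : ℝ :=
  if k ≤ n - p then 1
  else 1 - (((k : ℝ) - n + p) / ψ k) / ((p : ℝ) / ψ n)

/-- The sums `U^ψ_{n,p}(f;x)`. -/
def Usum (ψ : ℕ → ℝ) (n p : ℕ) (f : ℝ → ℝ) (x : ℝ) : ℝ :=
  ∑ k ∈ Finset.range n, lambdaU ψ n p k * harmonicTerm f k x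

/-- `E(C^ψ_{β,∞}; T) = sup_{f ∈ C^ψ_{β,∞}} ‖f - T f‖_C`. -/
def classSup (ψ : ℕ → ℝ) (β : ℝ) (T : (ℝ → ℝ) → ℝ → ℝ) : ℝ :=
  sSup {e | ∃ f, ClassC ψ β f ∧ e = ⨆ x : ℝ, |f x - T f x|}

/-- The characteristic `η(ψ;t) = ψ⁻¹(ψ(t)/2)` (inverse taken on `[1,∞)`). -/
def eta (ψ : ℝ → ℝ) (t : ℝ) : ℝ := Function.invFunOn ψ (Set.Ici 1) (ψ t / 2)

/-- The set `M`: positive convex functions on `[1,∞)` vanishing at infinity. -/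
def MClass (ψ : ℝ → ℝ) : Prop :=
  (∀ t ≥ (1 : ℝ), 0 < ψ t) ∧ ConvexOn ℝ (Set.Ici 1) ψ ∧ Tendsto ψ atTop (nhds 0)

/-- The set `F = {ψ ∈ M : η'(ψ;t) ≤ K for all t ≥ 1}`. -/
def FClass (ψ : ℝ → ℝ) : Prop :=
  MClass ψ ∧ ∃ K : ℝ, ∀ t ≥ (1 : ℝ), DifferentiableAt ℝ (eta ψ) t ∧ deriv (eta ψ) t ≤ K

/-! ### Trigonometric sums with convex coefficients -/

theorem abs_sum_mul_sub_le {e x : ℕ → ℝ} {B : ℝ} (he : Antitone e) (he0 : ∀ j, 0 ≤ e j)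
    (hx : ∀ j, |x j| ≤ B) (N : ℕ) :
    |∑ j ∈ Finset.range N, e j * (x (j + 1) - x j)| ≤ 2 * B * e 0 := by
  have key : |∑ j ∈ Finset.range N, e j * (x (j + 1) - x j) - e N * x N + e 0 * x 0|
      ≤ B * (e 0 - e N) := by
    induction N with
    | zero => simp
    | succ N ih =>
      rw [Finset.sum_range_succ]
      have h1 : |(e N - e (N + 1)) * x (N + 1)| ≤ (e N - e (N + 1)) * B := by
        rw [abs_mul, abs_of_nonneg (sub_nonneg.2 (he (Nat.le_succ N)))]
        exact mul_le_mul_of_nonneg_left (hx _) (sub_nonneg.2 (he (Nat.le_succ N)))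
      have h2 := abs_le.1 ih
      have h3 := abs_le.1 h1
      rw [abs_le]
      constructor <;> nlinarith
  have h1 : |e N * x N| ≤ e N * B := by
    rw [abs_mul, abs_of_nonneg (he0 N)]
    exact mul_le_mul_of_nonneg_left (hx _) (he0 N)
  have h2 : |e 0 * x 0| ≤ e 0 * B := by
    rw [abs_mul, abs_of_nonneg (he0 0)]
    exact mul_le_mul_of_nonneg_left (hx _) (he0 0)
  have h2 := abs_le.1 h2
  have h3 := abs_le.1 h1
  have h4 := abs_le.1 key
  rw [abs_le]
  constructor <;> nlinarith

theorem sum_mul_sub_eq (g x : ℕ → ℝ) (N : ℕ) :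
    ∑ j ∈ Finset.range N, g j * (x (j + 1) - x j)
      = g N * x N - g 0 * x 0 + ∑ j ∈ Finset.range N, (g j - g (j + 1)) * x (j + 1) := by
  induction N with
  | zero => simp
  | succ N ih => rw [Finset.sum_range_succ, Finset.sum_range_succ, ih]; ring

theorem two_mul_abs_div_pi_le {u : ℝ} (hu : |u| ≤ π) : 2 * |u| / π ≤ |2 * Real.sin (u / 2)| := by
  have h := Real.mul_abs_le_abs_sin (x := u / 2) (by rw [abs_div]; norm_num; linarith)
  rw [abs_mul, abs_of_pos (by norm_num : (0:ℝ) < 2)]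
  rw [abs_div, abs_of_pos (by norm_num : (0:ℝ) < 2)] at h
  calc 2 * |u| / π = 2 * (2 / π * (|u| / 2)) := by ring
    _ ≤ _ := by linarith

theorem abs_sub_sin_le_sq {x : ℝ} (hx : |x| ≤ π / 2) : |x - Real.sin x| ≤ x ^ 2 := by
  wlog h0 : 0 ≤ x generalizing x
  · have := this (x := -x) (by rwa [abs_neg]) (by linarith)
    rwa [Real.sin_neg, neg_sq, show -x - -Real.sin x = -(x - Real.sin x) by ring, abs_neg] at this
  rw [abs_of_nonneg h0] at hx
  rw [abs_of_nonneg (sub_nonneg.2 (Real.sin_le h0))]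
  rcases h0.eq_or_lt with rfl | hpos
  · simp
  rcases le_or_gt x 1 with h1 | h1
  · have := Real.sin_gt_sub_cube hpos
    nlinarith [mul_nonneg (sq_nonneg x) (sub_nonneg.2 h1)]
  · have := Real.sin_nonneg_of_nonneg_of_le_pi h0 (by linarith [Real.pi_pos])
    nlinarith

theorem two_sin_half_mul_cos (u a : ℝ) (j : ℕ) :
    2 * Real.sin (u / 2) * Real.cos (j * u + a)
      = Real.sin (((j + 1 : ℕ) : ℝ) * u + (a - u / 2)) - Real.sin (j * u + (a - u / 2)) := by
  have e1 : ((j + 1 : ℕ) : ℝ) * u + (a - u / 2) = (j * u + a) + u / 2 := by push_cast; ring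
  have e2 : (j : ℝ) * u + (a - u / 2) = (j * u + a) - u / 2 := by ring
  rw [e1, e2, Real.sin_add, Real.sin_sub]; ring

theorem abs_two_sin_half_mul_sum_cos_le {g : ℕ → ℝ} (hg : Antitone g) (hg0 : ∀ j, 0 ≤ g j)
    (N : ℕ) (u a : ℝ) :
    |2 * Real.sin (u / 2)| * |∑ j ∈ Finset.range N, g j * Real.cos (j * u + a)| ≤ 2 * g 0 := by
  have := abs_sum_mul_sub_le (x := fun j : ℕ => Real.sin (j * u + (a - u / 2))) (B := 1) hg hg0
    (fun j => Real.abs_sin_le_one _) N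
  rw [← abs_mul, Finset.mul_sum]
  simp only [← two_sin_half_mul_cos] at this
  rw [Finset.sum_congr rfl fun j _ =>
    mul_left_comm (2 * Real.sin (u / 2)) (g j) (Real.cos (j * u + a))]
  linarith

theorem abs_sum_cos_add_le {g : ℕ → ℝ} (hg : Antitone g) (hg0 : ∀ j, 0 ≤ g j)
    (hd : Antitone fun j => g j - g (j + 1)) {N : ℕ} (hN : g N = 0) {u : ℝ} (hu : |u| ≤ π)
    (hu0 : u ≠ 0) (a : ℝ) :
    |∑ j ∈ Finset.range N, g j * Real.cos (j * u + a) + g 0 * (Real.sin a / u)|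
      ≤ 5 * (g 0 - g 1) / u ^ 2 + 2 * g 0 := by
  set s := 2 * Real.sin (u / 2) with hs
  have hup : 0 < |u| := abs_pos.2 hu0
  have hpi := Real.pi_pos
  have hsl : 2 * |u| / π ≤ |s| := two_mul_abs_div_pi_le hu
  have hsp : 0 < |s| := lt_of_lt_of_le (by positivity) hsl
  have hs0 : s ≠ 0 := abs_pos.1 hsp
  have hd0 : 0 ≤ g 0 - g 1 := sub_nonneg.2 (hg (by norm_num))
  set S := ∑ j ∈ Finset.range N, g j * Real.cos (j * u + a) with hS
  set D := ∑ j ∈ Finset.range N, (g j - g (j + 1)) *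
    Real.sin (((j + 1 : ℕ) : ℝ) * u + (a - u / 2)) with hD
  have e1 : s * S = - g 0 * Real.sin (a - u / 2) + D := by
    have := sum_mul_sub_eq g (fun j : ℕ => Real.sin (j * u + (a - u / 2))) N
    simp only [← two_sin_half_mul_cos, hN] at this
    rw [hS, Finset.mul_sum, hD]
    calc _ = ∑ j ∈ Finset.range N, g j * (2 * Real.sin (u / 2) * Real.cos (j * u + a)) :=
          Finset.sum_congr rfl fun j _ => by rw [hs]; ring
      _ = _ := by rw [this]; simp
  have e2 : |s| * |D| ≤ 2 * (g 0 - g 1) := by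
    have := abs_sum_mul_sub_le (x := fun j : ℕ => - Real.cos (j * u + a)) (B := 1) hd
      (fun j => sub_nonneg.2 (hg (Nat.le_succ j))) (by simpa using fun j => Real.abs_cos_le_one _) N
    rw [← abs_mul, hD, Finset.mul_sum]
    calc _ = |∑ j ∈ Finset.range N, (g j - g (j + 1)) *
              (- Real.cos (((j + 1 : ℕ) : ℝ) * u + a) - - Real.cos (j * u + a))| := by
          congr 1
          refine Finset.sum_congr rfl fun j _ => ?_
          have f1 : ((j + 1 : ℕ) : ℝ) * u + a = ((j + 1 : ℕ) * u + (a - u / 2)) + u / 2 := by ring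
          have f2 : (j : ℝ) * u + a = ((j + 1 : ℕ) * u + (a - u / 2)) - u / 2 := by
            push_cast; ring
          rw [f1, f2, Real.cos_add, Real.cos_sub, hs]; ring
      _ ≤ _ := by simpa using this
  have e3 : S + g 0 * (Real.sin a / u)
      = D / s + g 0 * ((Real.sin a - Real.sin (a - u / 2)) / s + Real.sin a * ((s - u) / (s * u))) := by
    have : S = (- g 0 * Real.sin (a - u / 2) + D) / s := by rw [← e1]; field_simp
    rw [this]; field_simp; ring
  have b1 : |D / s| ≤ 5 * (g 0 - g 1) / u ^ 2 := by
    rw [abs_div, div_le_div_iff₀ hsp (by positivity), ← sq_abs u]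
    have h1 : 2 * |u| ≤ π * |s| := by
      rw [div_le_iff₀ hpi] at hsl; linarith
    have h2 : 4 * |u| ^ 2 ≤ 10 * |s| ^ 2 := by
      have : (2 * |u|) ^ 2 ≤ (π * |s|) ^ 2 := by gcongr
      have hpi2 : π ^ 2 ≤ 10 := by nlinarith [Real.pi_lt_d2]
      nlinarith [sq_nonneg |s|, mul_le_mul_of_nonneg_right hpi2 (sq_nonneg |s|)]
    have h3 : |s| * (|D| * |u| ^ 2) ≤ |s| * (5 * (g 0 - g 1) * |s|) := by
      calc |s| * (|D| * |u| ^ 2) = (|s| * |D|) * |u| ^ 2 := by ring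
        _ ≤ 2 * (g 0 - g 1) * |u| ^ 2 := by gcongr
        _ ≤ 5 * (g 0 - g 1) * |s| ^ 2 := by nlinarith
        _ = _ := by ring
    exact le_of_mul_le_mul_left h3 hsp
  have b2 : |(Real.sin a - Real.sin (a - u / 2)) / s| ≤ 1 := by
    rw [abs_div, div_le_one hsp]
    have h1 : |Real.sin a - Real.sin (a - u / 2)| ≤ |u| / 2 := by
      have h := Real.sin_sub_sin a (a - u / 2)
      rw [h]
      have h2 : |Real.sin ((a - (a - u / 2)) / 2)| ≤ |u| / 4 := by
        have := Real.abs_sin_le_abs (x := (a - (a - u / 2)) / 2)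
        refine this.trans (le_of_eq ?_)
        rw [show (a - (a - u / 2)) / 2 = u / 4 by ring, abs_div]; norm_num
      rw [abs_mul, abs_mul, abs_of_pos (by norm_num : (0:ℝ) < 2)]
      have := Real.abs_cos_le_one ((a + (a - u / 2)) / 2)
      nlinarith [abs_nonneg (Real.cos ((a + (a - u / 2)) / 2)),
        abs_nonneg (Real.sin ((a - (a - u / 2)) / 2))]
    refine h1.trans (le_trans ?_ hsl)
    rw [div_le_div_iff₀ (by norm_num) hpi]
    nlinarith [Real.pi_lt_d2]
  have b3 : |Real.sin a * ((s - u) / (s * u))| ≤ 1 := by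
    have h1 : |s - u| ≤ |s * u| := by
      have h := abs_sub_sin_le_sq (x := u / 2) (by rw [abs_div]; norm_num; linarith)
      have h2 : |s - u| = 2 * |u / 2 - Real.sin (u / 2)| := by
        rw [← abs_neg, show -(s - u) = 2 * (u / 2 - Real.sin (u / 2)) by rw [hs]; ring, abs_mul]
        norm_num
      rw [h2, abs_mul]
      have h3 : 2 * |u| / π * |u| ≤ |s| * |u| := by gcongr
      have h4 : |u| * |u| / 2 ≤ 2 * |u| / π * |u| := by
        rw [div_mul_eq_mul_div, div_le_div_iff₀ (by norm_num) hpi]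
        nlinarith [Real.pi_lt_d2, mul_pos hup hup]
      nlinarith [sq_abs u]
    rw [abs_mul, abs_div]
    have := Real.abs_sin_le_one a
    have h2 : |s - u| / |s * u| ≤ 1 := div_le_one_of_le₀ h1 (abs_nonneg _)
    have h3 : 0 ≤ |s - u| / |s * u| := by positivity
    nlinarith [abs_nonneg (Real.sin a)]
  rw [e3]
  refine (abs_add_le _ _).trans (add_le_add b1 ?_)
  rw [abs_mul, abs_of_nonneg (hg0 0), mul_comm]
  refine mul_le_mul_of_nonneg_right ((abs_add_le _ _).trans (by linarith)) (hg0 0)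

theorem abs_sum_cos_le {g : ℕ → ℝ} (hg : Antitone g) (hg0 : ∀ j, 0 ≤ g j)
    (N : ℕ) {u : ℝ} (hu : |u| ≤ π) (a : ℝ) :
    |∑ j ∈ Finset.range N, g j * Real.cos (j * u + a)|
      ≤ 5 * ∑ j ∈ Finset.range N, (if (j : ℝ) * |u| ≤ 1 then g j else 0) := by
  have hpi := Real.pi_pos
  have triv : ∀ M : ℕ, |∑ j ∈ Finset.range M, g j * Real.cos (j * u + a)|
      ≤ ∑ j ∈ Finset.range M, g j := fun M =>
    (Finset.abs_sum_le_sum_abs _ _).trans (Finset.sum_le_sum fun j _ => by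
      rw [abs_mul, abs_of_nonneg (hg0 j)]
      exact mul_le_of_le_one_right (hg0 j) (Real.abs_cos_le_one _))
  by_cases hall : ∀ j ∈ Finset.range N, (j : ℝ) * |u| ≤ 1
  · rw [Finset.sum_congr rfl fun j hj => if_pos (hall j hj)]
    have := triv N
    have h0 : 0 ≤ ∑ j ∈ Finset.range N, g j := Finset.sum_nonneg fun j _ => hg0 j
    linarith
  push Not at hall
  obtain ⟨j₀, hj₀, hj1⟩ := hall
  have hup : 0 < |u| := by
    by_contra h
    have : |u| = 0 := le_antisymm (not_lt.1 h) (abs_nonneg u)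
    rw [this] at hj1; norm_num at hj1
  set M := ⌊1 / |u|⌋₊ + 1 with hM
  have hMlt : ∀ j : ℕ, j < M ↔ (j : ℝ) * |u| ≤ 1 := fun j => by
    rw [hM, Nat.lt_succ_iff, Nat.le_floor_iff (by positivity), le_div_iff₀ hup]
  have hMN : M ≤ N := by
    by_contra h
    have := (hMlt j₀).1 (by have := Finset.mem_range.1 hj₀; omega)
    linarith
  have hM1 : 1 ≤ M * |u| := by
    have : ¬ (M : ℝ) * |u| ≤ 1 := by rw [← hMlt]; simp
    linarith
  have hsum : ∑ j ∈ Finset.range M, g j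
      ≤ ∑ j ∈ Finset.range N, (if (j : ℝ) * |u| ≤ 1 then g j else 0) := by
    rw [← Finset.sum_range_add_sum_Ico _ hMN,
      Finset.sum_congr rfl fun j hj => if_pos ((hMlt j).1 (Finset.mem_range.1 hj))]
    exact le_add_of_nonneg_right (Finset.sum_nonneg fun j _ => by split_ifs; exacts [hg0 j, le_rfl])
  refine le_trans ?_ (mul_le_mul_of_nonneg_left hsum (by norm_num))
  have htail : |∑ j ∈ Finset.Ico M N, g j * Real.cos (j * u + a)|
      ≤ 4 * ∑ j ∈ Finset.range M, g j := by
    rw [Finset.sum_Ico_eq_sum_range]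
    have h1 := abs_two_sin_half_mul_sum_cos_le (g := fun j => g (M + j))
      (fun i j hij => hg (by omega)) (fun j => hg0 _) (N - M) u (M * u + a)
    have h2 : ∀ j : ℕ, ((M + j : ℕ) : ℝ) * u + a = j * u + (M * u + a) := fun j => by
      push_cast; ring
    simp only [h2]
    set T := |∑ j ∈ Finset.range (N - M), g (M + j) * Real.cos (j * u + (M * u + a))|
    have hT : 0 ≤ T := abs_nonneg _
    have h3 : M * g M ≤ ∑ j ∈ Finset.range M, g j := by
      have := Finset.card_nsmul_le_sum (Finset.range M) g (g M)
        fun j hj => hg (Finset.mem_range.1 hj).le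
      simpa using this
    have h4 := mul_le_mul_of_nonneg_right (two_mul_abs_div_pi_le hu) hT
    have h5 : 2 * |u| / π * T ≤ 2 * g M := h4.trans (by simpa using h1)
    have h6 : |u| * T ≤ π * g M := by
      rw [div_mul_eq_mul_div, div_le_iff₀ hpi] at h5; nlinarith
    have h7 : T ≤ M * (|u| * T) := by nlinarith
    have h8 : (M : ℝ) * (|u| * T) ≤ M * (π * g M) := by gcongr
    have h9 : (M : ℝ) * (π * g M) ≤ 4 * (M * g M) := by
      nlinarith [Real.pi_lt_d2, mul_nonneg (Nat.cast_nonneg (α := ℝ) M) (hg0 M)]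
    linarith
  rw [← Finset.sum_range_add_sum_Ico _ hMN]
  have := (abs_add_le (∑ j ∈ Finset.range M, g j * Real.cos (j * u + a))
    (∑ j ∈ Finset.Ico M N, g j * Real.cos (j * u + a))).trans (add_le_add (triv M) htail)
  linarith

/-- An integrable majorant, on `[-π, π]`, of the error made when a trigonometric sum with
coefficients `g` is replaced by `0` for `|u| ≤ 1 / H` and by `-G sin a / u` for `|u| ≥ 1 / H`. -/
def sumMajorant (g : ℕ → ℝ) (N : ℕ) (H A G u : ℝ) : ℝ :=
  5 * (∑ j ∈ Finset.range N, if |u| ≤ (max H j)⁻¹ then g j else 0) +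
    (3 * G + 10 * A * G * (H * (1 + (H * u) ^ 2)⁻¹))

theorem sumMajorant_neg (g : ℕ → ℝ) (N : ℕ) (H A G u : ℝ) :
    sumMajorant g N H A G (-u) = sumMajorant g N H A G u := by
  simp [sumMajorant]

section Majorant

variable {g : ℕ → ℝ} {N : ℕ} {H A G : ℝ}

theorem abs_sum_cos_le_sumMajorant (hg : Antitone g) (hg0 : ∀ j, 0 ≤ g j) (hH : 0 < H)
    (hA : 0 ≤ A) (hG : 0 ≤ G) {u : ℝ} (hu : |u| ≤ π) (huH : |u| ≤ 1 / H) (a : ℝ) :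
    |∑ j ∈ Finset.range N, g j * Real.cos (j * u + a)| ≤ sumMajorant g N H A G u := by
  refine (abs_sum_cos_le hg hg0 N hu a).trans ?_
  have h1 : ∑ j ∈ Finset.range N, (if (j : ℝ) * |u| ≤ 1 then g j else 0)
      ≤ ∑ j ∈ Finset.range N, (if |u| ≤ (max H j)⁻¹ then g j else 0) := by
    refine Finset.sum_le_sum fun j _ => ?_
    by_cases hj : (j : ℝ) * |u| ≤ 1
    · rw [if_pos hj, if_pos]
      rw [← one_div, le_div_iff₀ (lt_max_of_lt_left hH)]
      rw [le_div_iff₀ hH] at huH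
      rcases max_choice H (j : ℝ) with h | h <;> rw [h] <;> linarith
    · rw [if_neg hj]; split_ifs; exacts [hg0 j, le_rfl]
  have h2 : 0 ≤ 10 * A * G * (H * (1 + (H * u) ^ 2)⁻¹) := by positivity
  rw [sumMajorant]; linarith

theorem abs_sum_cos_add_le_sumMajorant (hg : Antitone g) (hg0 : ∀ j, 0 ≤ g j)
    (hd : Antitone fun j => g j - g (j + 1)) (hN : g N = 0) (hH : 0 < H)
    (hA : 0 ≤ A) (hG : 0 ≤ G) (hgG : g 0 ≤ G) (hGg : G - g 0 ≤ G / H)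
    (hdA : g 0 - g 1 ≤ A * G / H) {u : ℝ} (hu : |u| ≤ π) (huH : 1 / H ≤ |u|) (a : ℝ) :
    |∑ j ∈ Finset.range N, g j * Real.cos (j * u + a) + G * (Real.sin a / u)|
      ≤ sumMajorant g N H A G u := by
  have hup : 0 < |u| := lt_of_lt_of_le (by positivity) huH
  have hu0 : u ≠ 0 := abs_pos.1 hup
  have h1 := abs_sum_cos_add_le hg hg0 hd hN hu hu0 a
  have hHu : 1 ≤ H * |u| := by rwa [div_le_iff₀' hH] at huH
  have h2 : |(G - g 0) * (Real.sin a / u)| ≤ G := by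
    rw [abs_mul, abs_div, abs_of_nonneg (sub_nonneg.2 hgG)]
    calc (G - g 0) * (|Real.sin a| / |u|) ≤ G / H * (1 / |u|) := by
          gcongr
          exact Real.abs_sin_le_one a
      _ = G / (H * |u|) := by field_simp
      _ ≤ G := div_le_self hG hHu
  have h3 : 5 * (g 0 - g 1) / u ^ 2 ≤ 10 * A * G * (H * (1 + (H * u) ^ 2)⁻¹) := by
    have hsq : 1 ≤ (H * u) ^ 2 := by
      rw [← sq_abs, abs_mul, abs_of_pos hH]; exact one_le_pow₀ hHu
    have hu2 : 0 < u ^ 2 := by positivity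
    calc 5 * (g 0 - g 1) / u ^ 2 ≤ 5 * (A * G / H) / u ^ 2 := by gcongr
      _ = 10 * A * G * (H * (2 * (H * u) ^ 2)⁻¹) := by field_simp; ring
      _ ≤ _ := by gcongr; linarith
  have h4 : 0 ≤ 5 * ∑ j ∈ Finset.range N, (if |u| ≤ (max H j)⁻¹ then g j else 0) :=
    mul_nonneg (by norm_num) (Finset.sum_nonneg fun j _ => by split_ifs; exacts [hg0 j, le_rfl])
  rw [sumMajorant]
  have e : ∑ j ∈ Finset.range N, g j * Real.cos (j * u + a) + G * (Real.sin a / u)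
      = (∑ j ∈ Finset.range N, g j * Real.cos (j * u + a) + g 0 * (Real.sin a / u))
        + (G - g 0) * (Real.sin a / u) := by ring
  rw [e]
  refine (abs_add_le _ _).trans ?_
  linarith

theorem integrable_ite_abs_le (w c : ℝ) : Integrable fun u : ℝ => if |u| ≤ w then c else 0 := by
  have : (fun u : ℝ => if |u| ≤ w then c else 0) = (Icc (-w) w).indicator fun _ => c := by
    ext u; simp [indicator_apply, abs_le]
  rw [this, integrable_indicator_iff measurableSet_Icc]
  exact integrableOn_const (by simp)

theorem integral_ite_abs_le {w : ℝ} (hw : 0 ≤ w) (c : ℝ) :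
    ∫ u : ℝ, (if |u| ≤ w then c else 0) = 2 * w * c := by
  have : (fun u : ℝ => if |u| ≤ w then c else 0) = (Icc (-w) w).indicator fun _ => c := by
    ext u; simp [indicator_apply, abs_le]
  rw [this, integral_indicator measurableSet_Icc, setIntegral_const]
  simp only [smul_eq_mul, Measure.real, Real.volume_Icc]
  rw [ENNReal.toReal_ofReal (by linarith)]; ring

theorem integrableOn_sumMajorant (g : ℕ → ℝ) (N : ℕ) (hH : 0 < H) (A G : ℝ) :
    IntegrableOn (sumMajorant g N H A G) (Icc (-π) π) := by
  refine Integrable.add ?_ (Integrable.add (integrableOn_const (by simp)) ?_)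
  · exact ((integrable_finsetSum _ fun j _ => integrable_ite_abs_le _ _).const_mul 5).integrableOn
  · exact (((integrable_inv_one_add_sq.comp_mul_left' hH.ne').const_mul H).const_mul
      (10 * A * G)).integrableOn

theorem integral_sumMajorant_le (hg0 : ∀ j, 0 ≤ g j) (hH : 0 < H) (hA : 0 ≤ A) (hG : 0 ≤ G)
    {B : ℝ} (hB : ∑ j ∈ Finset.range N, g j / max H j ≤ B * G) :
    ∫ u in Icc (-π) π, sumMajorant g N H A G u ≤ (10 * B + 20 + 40 * A) * G := by
  have i1 : Integrable fun u : ℝ =>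
      5 * (∑ j ∈ Finset.range N, if |u| ≤ (max H j)⁻¹ then g j else 0) :=
    (integrable_finsetSum _ fun j _ => integrable_ite_abs_le _ _).const_mul 5
  have i3 : Integrable fun u : ℝ => 10 * A * G * (H * (1 + (H * u) ^ 2)⁻¹) :=
    ((integrable_inv_one_add_sq.comp_mul_left' hH.ne').const_mul H).const_mul _
  have i2 : IntegrableOn (fun _ : ℝ => 3 * G) (Icc (-π) π) := integrableOn_const (by simp)
  have e : ∫ u in Icc (-π) π, sumMajorant g N H A G u
      = (∫ u in Icc (-π) π, 5 * (∑ j ∈ Finset.range N, if |u| ≤ (max H j)⁻¹ then g j else 0)) +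
        ((∫ u in Icc (-π) π, 3 * G) +
          ∫ u in Icc (-π) π, 10 * A * G * (H * (1 + (H * u) ^ 2)⁻¹)) := by
    rw [← integral_add i2 i3.integrableOn]
    exact integral_add i1.integrableOn (i2.add i3.integrableOn)
  have b1 : (∫ u in Icc (-π) π, 5 * (∑ j ∈ Finset.range N, if |u| ≤ (max H j)⁻¹ then g j else 0))
      ≤ 10 * (B * G) := by
    refine (setIntegral_le_integral i1 (ae_of_all _ fun u => mul_nonneg (by norm_num)
      (Finset.sum_nonneg fun j _ => by split_ifs; exacts [hg0 j, le_rfl]))).trans ?_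
    rw [integral_const_mul, integral_finsetSum _ fun j _ => integrable_ite_abs_le _ _]
    have : ∑ j ∈ Finset.range N, ∫ u : ℝ, (if |u| ≤ (max H j)⁻¹ then g j else 0)
        = 2 * ∑ j ∈ Finset.range N, g j / max H j := by
      rw [Finset.mul_sum]
      refine Finset.sum_congr rfl fun j _ => ?_
      rw [integral_ite_abs_le (inv_nonneg.2 (le_max_of_le_left hH.le))]; ring
    rw [this]; linarith
  have b2 : (∫ u in Icc (-π) π, 3 * G) ≤ 20 * G := by
    rw [setIntegral_const]
    simp only [smul_eq_mul, Measure.real, Real.volume_Icc]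
    rw [ENNReal.toReal_ofReal (by linarith [Real.pi_pos])]
    nlinarith [Real.pi_lt_d2]
  have b3 : (∫ u in Icc (-π) π, 10 * A * G * (H * (1 + (H * u) ^ 2)⁻¹)) ≤ 40 * A * G := by
    refine (setIntegral_le_integral i3 (ae_of_all _ fun u => by
      simp only [Pi.zero_apply]; positivity)).trans ?_
    rw [integral_const_mul, integral_const_mul,
      Measure.integral_comp_mul_left (fun x : ℝ => (1 + x ^ 2)⁻¹) H, integral_univ_inv_one_add_sq,
      abs_of_pos (inv_pos.2 hH), smul_eq_mul, mul_inv_cancel_left₀ hH.ne']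
    nlinarith [Real.pi_lt_d2, mul_nonneg hA hG]
  rw [e]; linarith

end Majorant

/-! ### The classes `M` and `F` -/

section PsiClasses

variable {ψ : ℝ → ℝ}

theorem MClass.strictAntiOn (h : MClass ψ) : StrictAntiOn ψ (Ici 1) := by
  intro a ha b hb hab
  obtain ⟨hpos, hconv, hlim⟩ := h
  have hev := (hlim.eventually_lt_const (hpos b hb)).and (eventually_gt_atTop b)
  obtain ⟨c, hc1, hc2⟩ := hev.exists
  have := hconv.slope_mono_adjacent ha (le_trans hb hc2.le : (1:ℝ) ≤ c) hab hc2
  have h2 : (ψ c - ψ b) / (c - b) < 0 := div_neg_of_neg_of_pos (by linarith) (by linarith)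
  have h3 := this.trans_lt h2
  rw [div_lt_iff₀ (by linarith)] at h3
  linarith

theorem MClass.continuousOn (h : MClass ψ) : ContinuousOn ψ (Ioi 1) :=
  (h.2.1.subset Ioi_subset_Ici_self (convex_Ioi 1)).continuousOn isOpen_Ioi

theorem MClass.eta_spec (h : MClass ψ) {t : ℝ} (ht : 1 < t) :
    t < eta ψ t ∧ ψ (eta ψ t) = ψ t / 2 := by
  have hpt := h.1 t ht.le
  obtain ⟨c, hc1, hc2⟩ :=
    ((h.2.2.eventually_lt_const (half_pos hpt)).and (eventually_gt_atTop t)).exists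
  have hcont : ContinuousOn ψ (Icc t c) :=
    h.continuousOn.mono fun x hx => lt_of_lt_of_le ht hx.1
  obtain ⟨x, hx, hxe⟩ := intermediate_value_Icc' hc2.le hcont
    (show ψ t / 2 ∈ Icc (ψ c) (ψ t) from ⟨hc1.le, by linarith⟩)
  have hmem : ∃ a ∈ Ici (1:ℝ), ψ a = ψ t / 2 := ⟨x, ht.le.trans hx.1, hxe⟩
  have h1 : eta ψ t ∈ Ici (1:ℝ) := Function.invFunOn_mem hmem
  have h2 : ψ (eta ψ t) = ψ t / 2 := Function.invFunOn_eq hmem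
  refine ⟨?_, h2⟩
  by_contra hle
  have := h.strictAntiOn.antitoneOn h1 ht.le (not_lt.1 hle)
  linarith

theorem MClass.one_lt_eta_one (h : MClass ψ) (hd : ContinuousAt (eta ψ) 1) : 1 < eta ψ 1 := by
  set L := sSup (ψ '' Ioi 1) with hL
  have hbdd : BddAbove (ψ '' Ioi 1) := ⟨ψ 1, by
    rintro _ ⟨x, hx, rfl⟩
    exact h.strictAntiOn.antitoneOn self_mem_Ici (Ioi_subset_Ici_self hx) (le_of_lt hx)⟩
  have hLpos : 0 < L := (h.1 2 (by norm_num)).trans_le (le_csSup hbdd ⟨2, by norm_num, rfl⟩)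
  obtain ⟨_, ⟨s, hs, rfl⟩, hsL⟩ :=
    exists_lt_of_lt_csSup ((nonempty_Ioi (a := (1:ℝ))).image ψ) (half_lt_self hLpos)
  have key : ∀ t > (1:ℝ), s ≤ eta ψ t := fun t ht => by
    obtain ⟨h1, h2⟩ := h.eta_spec ht
    by_contra hlt
    have h3 := h.strictAntiOn (ht.le.trans h1.le : (1:ℝ) ≤ _) (Ioi_subset_Ici_self hs) (not_le.1 hlt)
    have h4 : ψ t ≤ L := le_csSup hbdd ⟨t, ht, rfl⟩
    linarith
  have : s ≤ eta ψ 1 := ge_of_tendsto (hd.tendsto.mono_left nhdsWithin_le_nhds)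
    (eventually_mem_nhdsWithin.mono fun t ht => key t ht : ∀ᶠ t in nhdsWithin 1 (Ioi 1), s ≤ eta ψ t)
  exact lt_of_lt_of_le hs this

theorem MClass.lt_eta (h : MClass ψ) (hd : ContinuousAt (eta ψ) 1) {t : ℝ} (ht : 1 ≤ t) :
    t < eta ψ t := by
  rcases ht.eq_or_lt with rfl | h1
  · exact h.one_lt_eta_one hd
  · exact (h.eta_spec h1).1

theorem eta_sub_le {K : ℝ}
    (hK : ∀ t ≥ (1 : ℝ), DifferentiableAt ℝ (eta ψ) t ∧ deriv (eta ψ) t ≤ K) {x y : ℝ}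
    (hx : 1 ≤ x) (hxy : x ≤ y) : eta ψ y - eta ψ x ≤ K * (y - x) :=
  (convex_Ici 1).image_sub_le_mul_sub_of_deriv_le
    (fun t ht => (hK t ht).1.continuousAt.continuousWithinAt)
    (fun t ht => (hK t (interior_subset ht)).1.differentiableWithinAt)
    (fun t ht => (hK t (interior_subset ht)).2) x hx y (hx.trans hxy) hxy

theorem MClass.sub_le_of_one_lt (h : MClass ψ) {K : ℝ}
    (hK : ∀ t ≥ (1 : ℝ), DifferentiableAt ℝ (eta ψ) t ∧ deriv (eta ψ) t ≤ K) {t : ℝ}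
    (ht : 1 < t) : ψ t - ψ (t + 1) ≤ K * ψ t / (eta ψ t - t) := by
  obtain ⟨a1, a2⟩ := h.eta_spec ht
  obtain ⟨b1, b2⟩ := h.eta_spec (show 1 < t + 1 by linarith)
  have hlt : eta ψ t < eta ψ (t + 1) := by
    by_contra hle
    have h1 := h.strictAntiOn.antitoneOn (show (1:ℝ) ≤ eta ψ (t + 1) by linarith)
      (show (1:ℝ) ≤ eta ψ t by linarith) (not_lt.1 hle)
    have h2 := h.strictAntiOn (show (1:ℝ) ≤ t from ht.le) (show (1:ℝ) ≤ t + 1 by linarith)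
      (lt_add_one t)
    linarith
  have hs := h.2.1.slope_mono_adjacent (show (1:ℝ) ≤ t from ht.le)
    (show (1:ℝ) ≤ eta ψ (t + 1) by linarith) a1 hlt
  have hm := eta_sub_le hK ht.le (lt_add_one t).le
  rw [a2, b2] at hs
  have hgap : 0 < eta ψ t - t := sub_pos.2 a1
  rw [div_le_div_iff₀ hgap (sub_pos.2 hlt)] at hs
  rw [le_div_iff₀ hgap]
  have hp := h.1 t ht.le
  nlinarith

/-- The consequences of `ψ ∈ F` used for the estimates: the first difference of `ψ` at `n` is
controlled by the scale `η(n) - n`, and `ψ(n + ·)` decays like a power beyond that scale. -/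
theorem FClass.exists_bounds (hψ : FClass ψ) :
    ∃ (A : ℝ) (L : ℕ), 0 ≤ A ∧ 2 ≤ L ∧ ∀ n : ℕ, 1 ≤ n → 0 < eta ψ n - n ∧
      ψ n - ψ (n + 1) ≤ A * ψ n / max (eta ψ n - n) 1 ∧
      ∀ k : ℕ, eta ψ n - n ≤ k → ψ (n + L * k) ≤ ψ (n + k) / 2 := by
  obtain ⟨h, K, hK⟩ := hψ
  have hc := (hK 1 le_rfl).1.continuousAt
  have hn0 : ∀ n : ℕ, 1 ≤ n → 0 < eta ψ n - n := fun n hn =>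
    sub_pos.2 (h.lt_eta hc (by exact_mod_cast hn))
  refine ⟨max (max K 1) (eta ψ 1 - 1), ⌈max K 0⌉₊ + 2, by positivity, by omega,
    fun n hn => ⟨hn0 n hn, ?_, ?_⟩⟩
  · have hn1 : (1:ℝ) ≤ n := by exact_mod_cast hn
    have hp := h.1 n hn1
    have hp' := h.1 (n + 1) (by linarith)
    rw [le_div_iff₀ (by positivity)]
    set C := max (max K 1) (eta ψ 1 - 1)
    have hC1 : 1 ≤ C := (le_max_right _ _).trans (le_max_left _ _)
    have hCK : K ≤ C := (le_max_left _ _).trans (le_max_left _ _)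
    have hCe : eta ψ 1 - 1 ≤ C := le_max_right _ _
    rcases max_choice (eta ψ n - n) 1 with e | e <;> rw [e]
    · rcases hn1.eq_or_lt with e1 | h1
      · rw [← e1] at hp hp' ⊢
        have := h.lt_eta hc le_rfl
        nlinarith
      · have := h.sub_le_of_one_lt hK h1
        rw [le_div_iff₀ (hn0 n hn)] at this
        nlinarith
    · nlinarith
  · intro k hk
    have hn1 : (1:ℝ) ≤ n := by exact_mod_cast hn
    have hk0 : 0 < (k : ℝ) := (hn0 n hn).trans_le hk
    obtain ⟨a1, a2⟩ := h.eta_spec (show (1:ℝ) < n + k by linarith)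
    rw [← a2]
    have hm := eta_sub_le hK hn1 (show (n : ℝ) ≤ n + k by linarith)
    refine h.strictAntiOn.antitoneOn (show (1:ℝ) ≤ _ by linarith) (show (1:ℝ) ≤ _ from ?_) ?_
    · have : 0 ≤ ((⌈max K 0⌉₊ + 2 : ℕ) : ℝ) * k := by positivity
      linarith
    · have h1 : K ≤ ⌈max K 0⌉₊ := (le_max_left _ _).trans (Nat.le_ceil _)
      push_cast
      nlinarith

theorem sum_div_Ico_pow_le {a : ℕ → ℝ} (ha : Antitone a) (ha0 : ∀ j, 0 ≤ a j) {L m : ℕ}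
    (hL : 1 ≤ L) (hm : 1 ≤ m) (hdec : ∀ k, m ≤ k → a (L * k) ≤ a k / 2) (i : ℕ) :
    a (L ^ i * m) ≤ a m / 2 ^ i ∧
      ∑ j ∈ Finset.Ico m (L ^ i * m), a j / j ≤ 2 * L * a m * (1 - 1 / 2 ^ i) := by
  induction i with
  | zero => simp
  | succ i ih =>
    obtain ⟨h1, h2⟩ := ih
    have hLi : 1 ≤ L ^ i := Nat.one_le_pow _ _ hL
    have hle : m ≤ L ^ i * m := Nat.le_mul_of_pos_left _ hLi
    have hle' : L ^ i * m ≤ L ^ (i + 1) * m :=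
      Nat.mul_le_mul_right _ (Nat.pow_le_pow_right hL (Nat.le_succ i))
    have e : L ^ (i + 1) * m = L * (L ^ i * m) := by ring
    refine ⟨?_, ?_⟩
    · rw [e, pow_succ, ← div_div]
      exact (hdec _ hle).trans (by linarith)
    · rw [← Finset.sum_Ico_consecutive _ hle hle']
      set q := L ^ i * m with hq
      have hq0 : (0:ℝ) < q := by exact_mod_cast (by omega : 0 < q)
      have h3 : ∑ j ∈ Finset.Ico q (L ^ (i + 1) * m), a j / j ≤ L * a q := by
        calc _ ≤ ∑ j ∈ Finset.Ico q (L ^ (i + 1) * m), a q / q := by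
              refine Finset.sum_le_sum fun j hj => ?_
              have hj := (Finset.mem_Ico.1 hj).1
              have : (q : ℝ) ≤ j := by exact_mod_cast hj
              exact div_le_div₀ (ha0 _) (ha hj) hq0 this
          _ = (L * q - q) * (a q / q) := by
              rw [Finset.sum_const, Nat.card_Ico, e, nsmul_eq_mul,
                Nat.cast_sub (Nat.le_mul_of_pos_left _ hL)]
              push_cast; ring
          _ ≤ (L * q) * (a q / q) := by
              have : 0 ≤ a q / q := div_nonneg (ha0 _) hq0.le
              nlinarith
          _ = L * a q := by field_simp
      have h4 : (L : ℝ) * a q ≤ L * (a m / 2 ^ i) := by gcongr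
      have e2 : 2 * L * a m * (1 - 1 / 2 ^ (i + 1))
          = 2 * L * a m * (1 - 1 / 2 ^ i) + L * (a m / 2 ^ i) := by
        rw [pow_succ]; field_simp; ring
      rw [e2]; linarith

theorem sum_div_max_le {a : ℕ → ℝ} (ha : Antitone a) (ha0 : ∀ j, 0 ≤ a j) {L : ℕ}
    (hL : 2 ≤ L) {H : ℝ} (hH : 1 ≤ H) (hdec : ∀ k : ℕ, H ≤ k → a (L * k) ≤ a k / 2) (N : ℕ) :
    ∑ j ∈ Finset.range N, a j / max H j ≤ (2 + 2 * L) * a 0 := by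
  have hH0 : 0 < H := by linarith
  set m := ⌈H⌉₊ with hm
  have hm1 : 1 ≤ m := Nat.one_le_ceil_iff.2 hH0
  have hHm : H ≤ m := Nat.le_ceil _
  have hmH : (m : ℝ) ≤ 2 * H := by linarith [Nat.ceil_lt_add_one hH0.le]
  have hNle : N ≤ L ^ N * m :=
    (Nat.lt_pow_self (by omega)).le.trans (Nat.le_mul_of_pos_right _ hm1)
  have hmle : m ≤ L ^ N * m := Nat.le_mul_of_pos_left _ (Nat.one_le_pow _ _ (by omega))
  have hnn : ∀ j : ℕ, 0 ≤ a j / max H j := fun j => div_nonneg (ha0 j) (le_max_of_le_left hH0.le)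
  calc _ ≤ ∑ j ∈ Finset.range (L ^ N * m), a j / max H j :=
        Finset.sum_le_sum_of_subset_of_nonneg (Finset.range_mono hNle) fun j _ _ => hnn j
    _ = ∑ j ∈ Finset.range m, a j / max H j + ∑ j ∈ Finset.Ico m (L ^ N * m), a j / max H j :=
        (Finset.sum_range_add_sum_Ico _ hmle).symm
    _ ≤ 2 * a 0 + 2 * L * a 0 := by
        refine add_le_add ?_ ?_
        · calc _ ≤ ∑ j ∈ Finset.range m, a 0 / H := Finset.sum_le_sum fun j _ =>
                div_le_div₀ (ha0 0) (ha (Nat.zero_le j)) hH0 (le_max_left _ _)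
            _ = m * a 0 / H := by rw [Finset.sum_const, Finset.card_range, nsmul_eq_mul]; ring
            _ ≤ 2 * a 0 := by
                rw [div_le_iff₀ hH0]; nlinarith [ha0 0]
        · calc _ = ∑ j ∈ Finset.Ico m (L ^ N * m), a j / j := by
                refine Finset.sum_congr rfl fun j hj => ?_
                rw [max_eq_right (hHm.trans (by exact_mod_cast (Finset.mem_Ico.1 hj).1))]
            _ ≤ 2 * L * a m * (1 - 1 / 2 ^ N) := (sum_div_Ico_pow_le ha ha0 (by omega) hm1
                (fun k hk => hdec k (hHm.trans (by exact_mod_cast hk))) N).2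
            _ ≤ 2 * L * a m * 1 := by
                have := ha0 m
                gcongr
                have : (0:ℝ) < 1 / 2 ^ N := by positivity
                linarith
            _ ≤ 2 * L * a 0 := by
                rw [mul_one]; gcongr; exact ha (Nat.zero_le m)
    _ = _ := by ring

end PsiClasses

/-! ### Fejér means -/

/-- The Fejér kernel. -/
def fejerKernel (N : ℕ) (t : ℝ) : ℝ :=
  ∑ k ∈ Finset.range N, (if k = 0 then 1 else 2) * (1 - k / N) * Real.cos (k * t)

theorem continuous_fejerKernel (N : ℕ) : Continuous (fejerKernel N) := by
  unfold fejerKernel; fun_prop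

theorem sum_cos_mul_one_sub_cos (N : ℕ) (t : ℝ) :
    (∑ k ∈ Finset.range (N + 1), (if k = 0 then 1 else 2) * Real.cos (k * t)) * (1 - Real.cos t)
      = Real.cos (N * t) - Real.cos ((N + 1 : ℕ) * t) := by
  induction N with
  | zero => simp
  | succ N ih =>
    rw [Finset.sum_range_succ, add_mul, ih, if_neg (Nat.succ_ne_zero N)]
    have e1 : ((N + 1 + 1 : ℕ) : ℝ) * t = (N + 1 : ℕ) * t + t := by push_cast; ring
    have e2 : (N : ℝ) * t = (N + 1 : ℕ) * t - t := by push_cast; ring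
    rw [e1, e2, Real.cos_add, Real.cos_sub]; ring

theorem sum_weight_cos_mul_one_sub_cos (N : ℕ) (t : ℝ) :
    (∑ k ∈ Finset.range N, (if k = 0 then 1 else 2) * ((N : ℝ) - k) * Real.cos (k * t))
      * (1 - Real.cos t) = 1 - Real.cos (N * t) := by
  induction N with
  | zero => simp
  | succ N ih =>
    have e : ∑ k ∈ Finset.range (N + 1), (if k = 0 then 1 else 2) * (((N + 1 : ℕ) : ℝ) - k)
          * Real.cos (k * t)
        = ∑ k ∈ Finset.range N, (if k = 0 then 1 else 2) * ((N : ℝ) - k) * Real.cos (k * t)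
          + ∑ k ∈ Finset.range (N + 1), (if k = 0 then 1 else 2) * Real.cos (k * t) := by
      rw [Finset.sum_range_succ, Finset.sum_range_succ, ← add_assoc, ← Finset.sum_add_distrib]
      congr 1
      · exact Finset.sum_congr rfl fun k _ => by push_cast; ring
      · push_cast; ring
    rw [e, add_mul, ih, sum_cos_mul_one_sub_cos]; ring

theorem fejerKernel_mul_one_sub_cos {N : ℕ} (hN : N ≠ 0) (t : ℝ) :
    N * fejerKernel N t * (1 - Real.cos t) = 1 - Real.cos (N * t) := by
  rw [← sum_weight_cos_mul_one_sub_cos, fejerKernel, Finset.mul_sum]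
  congr 1
  exact Finset.sum_congr rfl fun k _ => by field_simp

theorem fejerKernel_nonneg (N : ℕ) (t : ℝ) : 0 ≤ fejerKernel N t := by
  rcases eq_or_ne N 0 with rfl | hN
  · simp [fejerKernel]
  have hN' : (0:ℝ) < N := by exact_mod_cast Nat.pos_of_ne_zero hN
  have h := fejerKernel_mul_one_sub_cos hN t
  rcases (Real.cos_le_one t).eq_or_lt with h1 | h1
  · have hz : ∀ k : ℕ, Real.cos (k * t) = 1 := by
      obtain ⟨m, hm⟩ := (Real.cos_eq_one_iff t).1 h1
      intro k
      rw [Real.cos_eq_one_iff]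
      exact ⟨k * m, by rw [← hm]; push_cast; ring⟩
    refine Finset.sum_nonneg fun k hk => ?_
    rw [hz]
    have : (k : ℝ) / N ≤ 1 :=
      div_le_one_of_le₀ (by exact_mod_cast (Finset.mem_range.1 hk).le) hN'.le
    have h2 : (0:ℝ) ≤ if k = 0 then 1 else 2 := by split_ifs <;> norm_num
    exact mul_nonneg (mul_nonneg h2 (by linarith)) zero_le_one
  · by_contra hlt
    have h2 := mul_neg_of_neg_of_pos (mul_neg_of_pos_of_neg hN' (not_le.1 hlt)) (sub_pos.2 h1)
    linarith [Real.cos_le_one (N * t)]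

theorem fejerKernel_le {N : ℕ} (hN : N ≠ 0) {t δ : ℝ} (hδ : 0 < δ) (h1 : δ ≤ |t|)
    (h2 : |t| ≤ π) : fejerKernel N t ≤ π ^ 2 / δ ^ 2 / N := by
  have hN' : (0:ℝ) < N := by exact_mod_cast Nat.pos_of_ne_zero hN
  have h := fejerKernel_mul_one_sub_cos hN t
  have hc := Real.cos_le_one_sub_mul_cos_sq h2
  have hsq : δ ^ 2 ≤ t ^ 2 := by rw [← sq_abs t]; gcongr
  have h3 : 2 / π ^ 2 * δ ^ 2 ≤ 1 - Real.cos t := by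
    have : 2 / π ^ 2 * δ ^ 2 ≤ 2 / π ^ 2 * t ^ 2 := by gcongr
    linarith
  have h4 : N * fejerKernel N t * (2 / π ^ 2 * δ ^ 2) ≤ 2 := by
    have h0 : 0 ≤ N * fejerKernel N t := mul_nonneg hN'.le (fejerKernel_nonneg N t)
    have := mul_le_mul_of_nonneg_left h3 h0
    linarith [Real.neg_one_le_cos (N * t)]
  have hpi := Real.pi_pos
  rw [le_div_iff₀ hN', le_div_iff₀ (by positivity)]
  have h5 : N * fejerKernel N t * (2 / π ^ 2 * δ ^ 2) * (π ^ 2 / 2)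
      ≤ 2 * (π ^ 2 / 2) := by gcongr
  calc _ = N * fejerKernel N t * (2 / π ^ 2 * δ ^ 2) * (π ^ 2 / 2) := by field_simp
    _ ≤ _ := by linarith

theorem integral_cos_nat_mul (k : ℕ) :
    ∫ t in (-π)..π, Real.cos (k * t) = if k = 0 then 2 * π else 0 := by
  split_ifs with h
  · subst h; simp; ring
  · have hk : (k : ℝ) ≠ 0 := by exact_mod_cast h
    rw [intervalIntegral.integral_comp_mul_left (fun x => Real.cos x) hk, integral_cos]
    simp [Real.sin_nat_mul_pi]

theorem integral_fejerKernel {N : ℕ} (hN : N ≠ 0) : ∫ t in (-π)..π, fejerKernel N t = 2 * π := by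
  unfold fejerKernel
  rw [intervalIntegral.integral_finsetSum fun k _ =>
    (Continuous.intervalIntegrable (by fun_prop) _ _)]
  simp only [intervalIntegral.integral_const_mul, integral_cos_nat_mul]
  rw [Finset.sum_eq_single 0]
  · simp
  · intro k _ hk; simp [hk]
  · intro h; exact absurd (Finset.mem_range.2 (Nat.pos_of_ne_zero hN)) h

theorem harmonicTerm_zero_eq (f : ℝ → ℝ) (k : ℕ) :
    harmonicTerm f k 0 = (if k = 0 then 1 else 2) * (1 / (2 * π)) *
      ∫ t in (-π)..π, f t * Real.cos (k * t) := by
  have hpi := Real.pi_pos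
  unfold harmonicTerm
  split_ifs with h
  · subst h; rw [fourierA]; field_simp
  · simp only [mul_zero, Real.cos_zero, Real.sin_zero, mul_one, add_zero]
    rw [fourierA]; field_simp

theorem fejerMean_eq {f : ℝ → ℝ} (hf : Continuous f) (N : ℕ) :
    ∑ k ∈ Finset.range N, (1 - (k : ℝ) / N) * harmonicTerm f k 0
      = ∫ t in Icc (-π) π, (1 / (2 * π) * fejerKernel N t) • f t := by
  rw [integral_Icc_eq_integral_Ioc, ← intervalIntegral.integral_of_le (by linarith [Real.pi_pos])]
  simp only [smul_eq_mul, mul_assoc, intervalIntegral.integral_const_mul]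
  simp only [fejerKernel, Finset.sum_mul]
  rw [intervalIntegral.integral_finsetSum fun k _ =>
    (Continuous.intervalIntegrable (by fun_prop) _ _), Finset.mul_sum]
  refine Finset.sum_congr rfl fun k _ => ?_
  rw [harmonicTerm_zero_eq]
  have : ∀ t, (if k = 0 then (1:ℝ) else 2) * (1 - k / N) * Real.cos (k * t) * f t
      = (if k = 0 then (1:ℝ) else 2) * (1 - k / N) * (f t * Real.cos (k * t)) := fun t => by ring
  simp only [this, intervalIntegral.integral_const_mul]
  ring

theorem tendsto_fejerMean {f : ℝ → ℝ} (hf : Continuous f) :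
    Tendsto (fun N : ℕ => ∑ k ∈ Finset.range N, (1 - (k : ℝ) / N) * harmonicTerm f k 0) atTop
      (nhds (f 0)) := by
  have hpi := Real.pi_pos
  simp only [fejerMean_eq hf]
  have hmem : Icc (-π) π ∈ nhdsWithin 0 (Icc (-π) π) := self_mem_nhdsWithin
  refine tendsto_setIntegral_peak_smul_of_integrableOn_of_tendsto (x₀ := 0) measurableSet_Icc
    measurableSet_Icc subset_rfl hmem (by simp) ?_ ?_ ?_ ?_ ?_ ?_
  · exact Eventually.of_forall fun N t _ => mul_nonneg (by positivity) (fejerKernel_nonneg N t)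
  · intro u hu h0
    obtain ⟨δ, hδ, hball⟩ := Metric.isOpen_iff.1 hu 0 h0
    rw [Metric.tendstoUniformlyOn_iff]
    intro ε hε
    have hlim : Tendsto (fun N : ℕ => 1 / (2 * π) * (π ^ 2 / δ ^ 2 / (N : ℝ))) atTop (nhds 0) := by
      simpa using (tendsto_const_div_atTop_nhds_zero_nat (π ^ 2 / δ ^ 2)).const_mul (1 / (2 * π))
    filter_upwards [hlim.eventually_lt_const hε, eventually_ne_atTop 0] with N hN hN0 t ht
    have h1 : δ ≤ |t| := by
      by_contra hlt
      exact ht.2 (hball (by simpa using not_le.1 hlt))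
    have hk := fejerKernel_le hN0 hδ h1 (abs_le.2 ht.1)
    have h2 : 0 ≤ 1 / (2 * π) * fejerKernel N t :=
      mul_nonneg (by positivity) (fejerKernel_nonneg N t)
    rw [Pi.zero_apply, dist_zero_left, Real.norm_of_nonneg h2]
    refine lt_of_le_of_lt ?_ hN
    gcongr
  · refine tendsto_const_nhds.congr' ?_
    filter_upwards [eventually_ne_atTop 0] with N hN
    rw [integral_Icc_eq_integral_Ioc, ← intervalIntegral.integral_of_le (by linarith),
      intervalIntegral.integral_const_mul, integral_fejerKernel hN]
    field_simp
  · exact Eventually.of_forall fun N =>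
      (continuous_const.mul (continuous_fejerKernel N)).aestronglyMeasurable
  · exact hf.continuousOn.integrableOn_compact isCompact_Icc
  · exact hf.continuousAt.tendsto.mono_left nhdsWithin_le_nhds

/-! ### The kernel of the deviation -/

theorem antitone_mul_of_nonneg {a b : ℕ → ℝ} (ha : Antitone a) (ha0 : ∀ j, 0 ≤ a j)
    (hb : Antitone b) (hb0 : ∀ j, 0 ≤ b j) : Antitone fun j => a j * b j := fun _ _ hij =>
  mul_le_mul (ha hij) (hb hij) (hb0 _) (ha0 _)

theorem antitone_sub_succ_mul {a b : ℕ → ℝ} (ha : Antitone a) (ha0 : ∀ j, 0 ≤ a j)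
    (hb : Antitone b) (hb0 : ∀ j, 0 ≤ b j) (hda : Antitone fun j => a j - a (j + 1))
    (hdb : Antitone fun j => b j - b (j + 1)) :
    Antitone fun j => a j * b j - a (j + 1) * b (j + 1) := by
  have h1 := antitone_mul_of_nonneg ha ha0 hdb fun j => sub_nonneg.2 (hb (Nat.le_succ j))
  have h2 := antitone_mul_of_nonneg (a := fun j => b (j + 1)) (fun i j hij => hb (by omega))
    (fun j => hb0 _) hda fun j => sub_nonneg.2 (ha (Nat.le_succ j))
  have e : (fun j => a j * b j - a (j + 1) * b (j + 1))
      = fun j => a j * (b j - b (j + 1)) + b (j + 1) * (a j - a (j + 1)) := by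
    ext j; ring
  rw [e]
  exact h1.add h2

/-- The truncated linear weights `(1 - (c + j) / p)₊`. -/
def rampWeight (c p : ℝ) (j : ℕ) : ℝ := max 0 (1 - (c + j) / p)

theorem rampWeight_nonneg (c p : ℝ) (j : ℕ) : 0 ≤ rampWeight c p j := le_max_left _ _

theorem antitone_rampWeight (c : ℝ) {p : ℝ} (hp : 0 < p) : Antitone (rampWeight c p) := by
  intro i j hij
  have : (i : ℝ) ≤ j := by exact_mod_cast hij
  unfold rampWeight
  gcongr

theorem antitone_rampWeight_sub (c : ℝ) {p : ℝ} (hp : 0 < p) :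
    Antitone fun j => rampWeight c p j - rampWeight c p (j + 1) := by
  refine antitone_nat_of_succ_le fun j => ?_
  have e1 : (c + ((j + 1 : ℕ) : ℝ)) / p = (c + j) / p + 1 / p := by push_cast; ring
  have e2 : (c + ((j + 1 + 1 : ℕ) : ℝ)) / p = (c + j) / p + 2 * (1 / p) := by push_cast; ring
  simp only [rampWeight, e1, e2]
  have : 0 < 1 / p := by positivity
  generalize (c + (j : ℝ)) / p = x at *
  generalize 1 / p = y at *
  rcases max_cases 0 (1 - x) with h | h <;> rcases max_cases 0 (1 - (x + y)) with h' | h' <;>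
    rcases max_cases 0 (1 - (x + 2 * y)) with h'' | h'' <;> linarith

/-- The coefficients, counted down from frequency `n`, of the deviation of `U^ψ_{n,p}` below
frequency `n`. -/
def lowCoeff (G : ℝ) (p j : ℕ) : ℝ := G * rampWeight 0 p j

/-- The coefficients, counted up from frequency `n`, of a Fejér mean of order `N` above
frequency `n`. -/
def highCoeff (ψ : ℝ → ℝ) (n N j : ℕ) : ℝ := ψ (n + j) * rampWeight n N j

/-- The kernel of the deviation of the Fejér mean of order `N` from `U^ψ_{n,p}`. -/
def deviationKernel (ψ : ℝ → ℝ) (n p N : ℕ) (u a : ℝ) : ℝ :=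
  (∑ j ∈ Finset.range (n + 1), lowCoeff (ψ n) p j * Real.cos (j * (-u) + a) - ψ n * Real.cos a) +
    ∑ j ∈ Finset.range (N - n), highCoeff ψ n N j * Real.cos (j * u + a)

/-- The main part of the kernel, where `r = 1 / p` and `s = 1 / H`. -/
def mainKernel (G r s u a : ℝ) : ℝ :=
  G * (Real.sin a / u) *
    ((if r < |u| ∧ |u| < s then 1 else 0) - if s < |u| ∧ |u| < r then 1 else 0)

theorem abs_sub_mainKernel_le {G r s u a S T c X Y Z : ℝ}
    (hS1 : |u| ≤ r → |S| ≤ X) (hS2 : r ≤ |u| → |S - G * (Real.sin a / u)| ≤ X)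
    (hT1 : |u| ≤ s → |T| ≤ Y) (hT2 : s ≤ |u| → |T + G * (Real.sin a / u)| ≤ Y) (hc : |c| ≤ Z) :
    |(S - c) + T - mainKernel G r s u a| ≤ X + Y + Z := by
  have combine : ∀ {S' T' : ℝ}, |S'| ≤ X → |T'| ≤ Y → |S' - c + T'| ≤ X + Y + Z := by
    intro S' T' hS hT
    have hS := abs_le.1 hS
    have hT := abs_le.1 hT
    have hc := abs_le.1 hc
    rw [abs_le]
    constructor <;> linarith
  unfold mainKernel
  rcases lt_or_ge |u| r with h1 | h1 <;> rcases lt_or_ge |u| s with h2 | h2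
  · rw [if_neg fun h => h.1.not_gt h1, if_neg fun h => h.1.not_gt h2]
    simpa using combine (hS1 h1.le) (hT1 h2.le)
  · rcases h2.eq_or_lt with h3 | h3
    · rw [if_neg fun h => h.1.not_gt h1, if_neg fun h => h.1.ne h3]
      simpa using combine (hS1 h1.le) (hT1 h3.ge)
    · rw [if_neg fun h => h.1.not_gt h1, if_pos ⟨h3, h1⟩]
      convert combine (hS1 h1.le) (hT2 h2) using 2
      ring
  · rcases h1.eq_or_lt with h3 | h3
    · rw [if_neg fun h => h.1.ne h3, if_neg fun h => h.1.not_gt h2]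
      simpa using combine (hS1 h3.ge) (hT1 h2.le)
    · rw [if_pos ⟨h3, h2⟩, if_neg fun h => h.1.not_gt h2]
      convert combine (hS2 h1) (hT1 h2.le) using 2
      ring
  · rw [if_neg fun h => h2.not_gt h.2, if_neg fun h => h1.not_gt h.2]
    convert combine (hS2 h1) (hT2 h2) using 2
    ring

theorem MClass.antitone_shift {ψ : ℝ → ℝ} (h : MClass ψ) {n : ℕ} (hn : 1 ≤ n) :
    Antitone fun j : ℕ => ψ (n + j) := fun i j hij => by
  have hn1 : (1:ℝ) ≤ n := by exact_mod_cast hn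
  have : (i : ℝ) ≤ j := by exact_mod_cast hij
  have hi : (0:ℝ) ≤ i := Nat.cast_nonneg i
  exact h.strictAntiOn.antitoneOn (show (1:ℝ) ≤ _ by linarith) (show (1:ℝ) ≤ _ by linarith)
    (by linarith)

theorem MClass.antitone_shift_sub {ψ : ℝ → ℝ} (h : MClass ψ) {n : ℕ} (hn : 1 ≤ n) :
    Antitone fun j : ℕ => ψ (n + j) - ψ (n + (j + 1 : ℕ)) := by
  have hn1 : (1:ℝ) ≤ n := by exact_mod_cast hn
  refine antitone_nat_of_succ_le fun j => ?_
  have hj : (0:ℝ) ≤ j := Nat.cast_nonneg j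
  have e2 : (n : ℝ) + ((j + 1 + 1 : ℕ) : ℝ) = n + (j + 1 : ℕ) + 1 := by push_cast; ring
  have := h.2.1.slope_mono_adjacent (x := (n + j : ℝ)) (y := n + (j + 1 : ℕ))
    (z := n + (j + 1 + 1 : ℕ)) (show (1:ℝ) ≤ _ by linarith)
    (show (1:ℝ) ≤ _ by push_cast; linarith) (by push_cast; linarith) (by push_cast; linarith)
  rw [show (n : ℝ) + ((j + 1 : ℕ) : ℝ) - (n + j) = 1 by push_cast; ring,
    show (n : ℝ) + ((j + 1 + 1 : ℕ) : ℝ) - (n + (j + 1 : ℕ)) = 1 by push_cast; ring] at this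
  linarith

theorem FClass.exists_deviationKernel_bound {ψ : ℝ → ℝ} (hψ : FClass ψ) :
    ∃ C : ℝ, ∀ n p : ℕ, 1 ≤ p → p ≤ n → ∀ᶠ N : ℕ in atTop, ∃ B : ℝ → ℝ,
      IntegrableOn B (Icc (-π) π) ∧ ∫ u in Icc (-π) π, B u ≤ C * ψ n ∧
      ∀ u : ℝ, |u| ≤ π → ∀ a : ℝ, |deviationKernel ψ n p N u a -
        mainKernel (ψ n) (1 / p) (1 / max (eta ψ n - n) 1) u a| ≤ B u := by
  obtain ⟨A, L, hA, hL, hb⟩ := hψ.exists_bounds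
  have hM := hψ.1
  refine ⟨(10 * 1 + 20 + 40 * 1) + (10 * (2 + 2 * L) + 20 + 40 * (A + 1)) + 7,
    fun n p hp hpn => ?_⟩
  have hn : 1 ≤ n := hp.trans hpn
  obtain ⟨-, hdiff, hdec⟩ := hb n hn
  set H := max (eta ψ n - n) 1 with hHdef
  have hH1 : 1 ≤ H := le_max_right _ _
  have hH0 : 0 < H := by linarith
  have hn1 : (1:ℝ) ≤ n := by exact_mod_cast hn
  have hp1 : (1:ℝ) ≤ p := by exact_mod_cast hp
  have hp0 : (0:ℝ) < p := by linarith
  have hG : 0 < ψ n := hM.1 n hn1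
  filter_upwards [eventually_ge_atTop (n + 1), eventually_ge_atTop ⌈n * H⌉₊] with N hN1 hN2
  have hNn : (n : ℝ) + 1 ≤ N := by exact_mod_cast hN1
  have hNH : n * H ≤ N := (Nat.le_ceil _).trans (by exact_mod_cast hN2)
  have hN0 : (0:ℝ) < N := by linarith
  -- the low frequencies
  have l1 : Antitone (lowCoeff (ψ n) p) := (antitone_rampWeight 0 hp0).const_mul hG.le
  have l2 : ∀ j, 0 ≤ lowCoeff (ψ n) p j := fun j => mul_nonneg hG.le (rampWeight_nonneg _ _ _)
  have l3 : Antitone fun j => lowCoeff (ψ n) p j - lowCoeff (ψ n) p (j + 1) := by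
    simpa only [lowCoeff, ← mul_sub] using (antitone_rampWeight_sub 0 hp0).const_mul hG.le
  have lz : ∀ j : ℕ, p ≤ j → lowCoeff (ψ n) p j = 0 := fun j hj => by
    have : (p : ℝ) ≤ j := by exact_mod_cast hj
    have h1 : 1 ≤ (0 + (j : ℝ)) / p := by rw [le_div_iff₀ hp0]; linarith
    rw [lowCoeff, rampWeight, max_eq_left (by linarith), mul_zero]
  have l4 : lowCoeff (ψ n) p (n + 1) = 0 := lz _ (by omega)
  have l0 : lowCoeff (ψ n) p 0 = ψ n := by simp [lowCoeff, rampWeight]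
  have l5 : lowCoeff (ψ n) p 0 - lowCoeff (ψ n) p 1 ≤ 1 * ψ n / p := by
    have h1 : 1 - 1 / (p : ℝ) ≤ rampWeight 0 p 1 := by
      rw [rampWeight]; simp
    have h2 : ψ n * (1 - 1 / (p : ℝ)) ≤ lowCoeff (ψ n) p 1 := by
      rw [lowCoeff]; gcongr
    rw [l0, one_mul, div_eq_mul_one_div]; linarith
  have l6 : ∑ j ∈ Finset.range (n + 1), lowCoeff (ψ n) p j / max (p : ℝ) j ≤ 1 * ψ n := by
    rw [← Finset.sum_range_add_sum_Ico _ (by omega : p ≤ n + 1),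
      Finset.sum_eq_zero (s := Finset.Ico p (n + 1)) fun j hj => by
        rw [lz j (Finset.mem_Ico.1 hj).1, zero_div], add_zero]
    calc _ ≤ ∑ j ∈ Finset.range p, ψ n / p := Finset.sum_le_sum fun j _ =>
          div_le_div₀ hG.le ((l1 (Nat.zero_le j)).trans l0.le) hp0 (le_max_left _ _)
      _ = 1 * ψ n := by rw [Finset.sum_const, Finset.card_range, nsmul_eq_mul]; field_simp
  -- the high frequencies
  have a1 := hM.antitone_shift hn
  have a2 : ∀ j : ℕ, 0 ≤ ψ (n + j) := fun j =>
    (hM.1 _ (by linarith [Nat.cast_nonneg (α := ℝ) j])).le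
  have h1 : Antitone (highCoeff ψ n N) :=
    antitone_mul_of_nonneg a1 a2 (antitone_rampWeight n hN0) (rampWeight_nonneg _ _)
  have h2 : ∀ j, 0 ≤ highCoeff ψ n N j := fun j => mul_nonneg (a2 j) (rampWeight_nonneg _ _ _)
  have h3 : Antitone fun j => highCoeff ψ n N j - highCoeff ψ n N (j + 1) :=
    antitone_sub_succ_mul a1 a2 (antitone_rampWeight n hN0) (rampWeight_nonneg _ _)
      (hM.antitone_shift_sub hn) (antitone_rampWeight_sub n hN0)
  have h4 : highCoeff ψ n N (N - n) = 0 := by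
    have : (n : ℝ) + ((N - n : ℕ) : ℝ) = N := by
      rw [Nat.cast_sub (by omega)]; ring
    rw [highCoeff, rampWeight, this, div_self hN0.ne']; simp
  have h0 : highCoeff ψ n N 0 = ψ n * (1 - n / N) := by
    have : (n : ℝ) / N ≤ 1 := div_le_one_of_le₀ (by linarith) hN0.le
    rw [highCoeff, rampWeight, max_eq_right] <;> simp [this]
  have h01 : highCoeff ψ n N 1 = ψ (n + 1) * (1 - (n + 1) / N) := by
    have : ((n : ℝ) + 1) / N ≤ 1 := div_le_one_of_le₀ hNn hN0.le
    rw [highCoeff, rampWeight, max_eq_right] <;> simp [this]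
  have hnN : (n : ℝ) / N ≤ 1 / H := by
    rw [div_le_div_iff₀ hN0 hH0]; linarith
  have hnN0 : (0:ℝ) ≤ n / N := by positivity
  have h5 : highCoeff ψ n N 0 ≤ ψ n := by rw [h0]; nlinarith
  have h6 : ψ n - highCoeff ψ n N 0 ≤ ψ n / H := by
    have e : ψ n / H = ψ n * (1 / H) := by ring
    rw [h0, e]; nlinarith
  have h7 : highCoeff ψ n N 0 - highCoeff ψ n N 1 ≤ (A + 1) * ψ n / H := by
    have hψ1 : ψ (n + 1) ≤ ψ n := by
      have := a1 (Nat.zero_le 1); simpa using this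
    have hψ1' : 0 ≤ ψ (n + 1) := (hM.1 _ (by linarith)).le
    have h1N : 1 / (N : ℝ) ≤ 1 / H := le_trans (by gcongr) hnN
    have h1N0 : 0 ≤ 1 / (N : ℝ) := by positivity
    have e : highCoeff ψ n N 0 - highCoeff ψ n N 1
        = (ψ n - ψ (n + 1)) * (1 - n / N) + ψ (n + 1) * (1 / N) := by
      rw [h0, h01]; ring
    have e2 : (A + 1) * ψ n / H = A * ψ n / H + ψ n * (1 / H) := by ring
    rw [e, e2]
    refine add_le_add (le_trans ?_ hdiff) (mul_le_mul hψ1 h1N h1N0 hG.le)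
    exact mul_le_of_le_one_right (sub_nonneg.2 hψ1) (by linarith)
  have h8 : ∑ j ∈ Finset.range (N - n), highCoeff ψ n N j / max H j ≤ (2 + 2 * L) * ψ n := by
    have := sum_div_max_le a1 a2 hL hH1 (fun k hk => by
      have := hdec k ((le_max_left _ _).trans hk)
      push_cast; exact this) (N - n)
    simp only [Nat.cast_zero, add_zero] at this
    refine le_trans (Finset.sum_le_sum fun j _ => ?_) this
    have : 0 ≤ max H (j : ℝ) := le_max_of_le_left hH0.le
    gcongr
    refine mul_le_of_le_one_right (a2 j) (max_le zero_le_one ?_)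
    have : (0:ℝ) ≤ (n + j) / N := by positivity
    linarith
  have iL := integrableOn_sumMajorant (lowCoeff (ψ n) p) (n + 1) hp0 1 (ψ n)
  have iH := integrableOn_sumMajorant (highCoeff ψ n N) (N - n) hH0 (A + 1) (ψ n)
  have iC : IntegrableOn (fun _ : ℝ => ψ n) (Icc (-π) π) := integrableOn_const (by simp)
  refine ⟨fun u => sumMajorant (lowCoeff (ψ n) p) (n + 1) p 1 (ψ n) u +
    sumMajorant (highCoeff ψ n N) (N - n) H (A + 1) (ψ n) u + ψ n, (iL.add iH).add iC, ?_, ?_⟩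
  · have e : ∫ u in Icc (-π) π, (sumMajorant (lowCoeff (ψ n) p) (n + 1) p 1 (ψ n) u +
          sumMajorant (highCoeff ψ n N) (N - n) H (A + 1) (ψ n) u + ψ n)
        = (∫ u in Icc (-π) π, sumMajorant (lowCoeff (ψ n) p) (n + 1) p 1 (ψ n) u) +
          (∫ u in Icc (-π) π, sumMajorant (highCoeff ψ n N) (N - n) H (A + 1) (ψ n) u) +
          ∫ u in Icc (-π) π, ψ n := by
      rw [← integral_add iL iH]
      exact integral_add (iL.add iH) iC
    have c1 := integral_sumMajorant_le l2 hp0 zero_le_one hG.le l6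
    have c2 := integral_sumMajorant_le h2 hH0 (by linarith : 0 ≤ A + 1) hG.le h8
    have c3 : (∫ u in Icc (-π) π, ψ n) ≤ 7 * ψ n := by
      rw [setIntegral_const]
      simp only [smul_eq_mul, Measure.real, Real.volume_Icc]
      rw [ENNReal.toReal_ofReal (by linarith [Real.pi_pos])]
      nlinarith [Real.pi_lt_d2]
    rw [e]; linarith
  · intro u hu a
    have hu' : |-u| ≤ π := by rwa [abs_neg]
    refine abs_sub_mainKernel_le (fun h => ?_) (fun h => ?_) (fun h => ?_) (fun h => ?_) ?_
    · rw [← sumMajorant_neg]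
      exact abs_sum_cos_le_sumMajorant l1 l2 hp0 zero_le_one hG.le hu' (by rwa [abs_neg]) a
    · rw [← sumMajorant_neg]
      have := abs_sum_cos_add_le_sumMajorant l1 l2 l3 l4 hp0 zero_le_one hG.le l0.le
        (by rw [l0, sub_self]; positivity) l5 hu' (by rwa [abs_neg]) a
      rwa [div_neg, mul_neg, ← sub_eq_add_neg] at this
    · exact abs_sum_cos_le_sumMajorant h1 h2 hH0 (by linarith) hG.le hu h a
    · exact abs_sum_cos_add_le_sumMajorant h1 h2 h3 h4 hH0 (by linarith) hG.le h5 h6 h7 hu h a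
    · rw [abs_mul, abs_of_pos hG]
      exact mul_le_of_le_one_right hG.le (Real.abs_cos_le_one a)

/-! ### Representation of the deviation -/

theorem SInf.integrableOn {φ : ℝ → ℝ} (h : SInf φ) {s : Set ℝ} (hs : volume s ≠ ⊤) :
    IntegrableOn φ s :=
  Measure.integrableOn_of_bounded hs h.1.aestronglyMeasurable (M := 1)
    (ae_restrict_of_ae (h.2.2.mono fun t ht => by rwa [Real.norm_eq_abs]))

theorem SInf.intervalIntegrable_mul {φ : ℝ → ℝ} (h : SInf φ) {g : ℝ → ℝ} (hg : Continuous g)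
    (a b : ℝ) : IntervalIntegrable (fun t => φ t * g t) volume a b := by
  refine IntervalIntegrable.mul_continuousOn ?_ hg.continuousOn
  rw [intervalIntegrable_iff]
  exact h.integrableOn (by simp [uIoc])

theorem IsPsiDeriv.harmonicTerm_zero {ψ : ℕ → ℝ} {β : ℝ} {f φ : ℝ → ℝ} (h : IsPsiDeriv ψ β f φ)
    {k : ℕ} (hk : 1 ≤ k) (hψ : ψ k ≠ 0) :
    harmonicTerm f k 0
      = ψ k / π * ∫ t in (-π)..π, φ t * Real.cos (k * t + β * π / 2) := by
  obtain ⟨h1, h2⟩ := h.2.2 k hk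
  set c := Real.cos (β * π / 2) with hc
  set s := Real.sin (β * π / 2) with hs
  have hcs : c ^ 2 + s ^ 2 = 1 := Real.cos_sq_add_sin_sq _
  have e1 : harmonicTerm f k 0 = ψ k * (fourierA φ k * c - fourierB φ k * s) := by
    rw [h1, h2, harmonicTerm, if_neg (by omega)]
    simp only [mul_zero, Real.cos_zero, Real.sin_zero, mul_one, add_zero]
    field_simp
    linear_combination (-fourierA f k) * hcs
  have e2 : ∫ t in (-π)..π, φ t * Real.cos (k * t + β * π / 2)
      = (∫ t in (-π)..π, φ t * Real.cos (k * t)) * c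
        - (∫ t in (-π)..π, φ t * Real.sin (k * t)) * s := by
    rw [← intervalIntegral.integral_mul_const, ← intervalIntegral.integral_mul_const,
      ← intervalIntegral.integral_sub
        ((h.1.intervalIntegrable_mul (by fun_prop) _ _).mul_const _)
        ((h.1.intervalIntegrable_mul (by fun_prop) _ _).mul_const _)]
    refine intervalIntegral.integral_congr fun t _ => ?_
    simp only [Real.cos_add, ← hc, ← hs]
    ring
  rw [e1, e2, fourierA, fourierB]
  ring

/-- The difference between the Fejér mean of order `N` and `U^ψ_{n,p}` at `0`, up to a term that
vanishes as `N → ∞`. -/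
def deviationSum (ψ : ℕ → ℝ) (n p N : ℕ) (f : ℝ → ℝ) : ℝ :=
  ∑ k ∈ Finset.range n, (1 - lambdaU ψ n p k) * harmonicTerm f k 0 +
    ∑ j ∈ Finset.range (N - n), (1 - ((n + j : ℕ) : ℝ) / N) * harmonicTerm f (n + j) 0

theorem tendsto_deviationSum (ψ : ℕ → ℝ) (n p : ℕ) {f : ℝ → ℝ} (hf : Continuous f) :
    Tendsto (fun N => deviationSum ψ n p N f) atTop (nhds (f 0 - Usum ψ n p f 0)) := by
  have h1 : Tendsto (fun N : ℕ => (∑ k ∈ Finset.range n, (k : ℝ) * harmonicTerm f k 0) / (N : ℝ))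
      atTop (nhds 0) := tendsto_const_div_atTop_nhds_zero_nat _
  have h2 := ((tendsto_fejerMean hf).sub_const (Usum ψ n p f 0)).add h1
  rw [add_zero] at h2
  refine h2.congr' ?_
  filter_upwards [eventually_ge_atTop n] with N hN
  rw [deviationSum, Usum, ← Finset.sum_range_add_sum_Ico _ hN, Finset.sum_Ico_eq_sum_range,
    Finset.sum_div, add_sub_right_comm, ← Finset.sum_sub_distrib, add_right_comm,
    ← Finset.sum_add_distrib]
  congr 1
  exact Finset.sum_congr rfl fun k _ => by ring

theorem one_sub_lambdaU_mul {ψ : ℝ → ℝ} (hpos : ∀ t ≥ (1 : ℝ), 0 < ψ t) {n p j : ℕ} (hp : 1 ≤ p)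
    (hpn : p ≤ n) (hj : j < n) (hk : 1 ≤ n - 1 - j) :
    (1 - lambdaU (fun k : ℕ => ψ k) n p (n - 1 - j)) * ψ (n - 1 - j : ℕ)
      = lowCoeff (ψ n) p (j + 1) := by
  have hp0 : (0:ℝ) < p := by exact_mod_cast hp
  have hkpos : 0 < ψ (n - 1 - j : ℕ) := hpos _ (by exact_mod_cast hk)
  have hnpos : 0 < ψ n := hpos _ (by exact_mod_cast hp.trans hpn)
  have hcast : ((n - 1 - j : ℕ) : ℝ) = n - (j + 1 : ℕ) := by
    rw [Nat.sub_sub, add_comm 1 j, Nat.cast_sub (by omega)]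
  rw [lambdaU, lowCoeff, rampWeight]
  split_ifs with h
  · have h1 : (p : ℝ) ≤ (j + 1 : ℕ) := by exact_mod_cast (by omega : p ≤ j + 1)
    have h2 : 1 ≤ (0 + ((j + 1 : ℕ) : ℝ)) / p := by rw [le_div_iff₀ hp0]; linarith
    rw [max_eq_left (by linarith)]; ring
  · have h1 : ((j + 1 : ℕ) : ℝ) ≤ p := by exact_mod_cast (by omega : j + 1 ≤ p)
    have h2 : (0 + ((j + 1 : ℕ) : ℝ)) / p ≤ 1 := by rw [div_le_one hp0]; linarith
    rw [max_eq_right (by linarith)]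
    have e : ((n - 1 - j : ℕ) : ℝ) - n + p = p - (j + 1 : ℕ) := by rw [hcast]; ring
    rw [e]
    field_simp
    ring

theorem IsPsiDeriv.deviationSum_eq {ψ : ℝ → ℝ} (hpos : ∀ t ≥ (1 : ℝ), 0 < ψ t) {β : ℝ}
    {f φ : ℝ → ℝ} (h : IsPsiDeriv (fun k : ℕ => ψ k) β f φ) {n p N : ℕ} (hp : 1 ≤ p)
    (hpn : p ≤ n) :
    deviationSum (fun k : ℕ => ψ k) n p N f
      = 1 / π * ∫ u in (-π)..π, φ u * deviationKernel ψ n p N u (n * u + β * π / 2) := by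
  have hn : 1 ≤ n := hp.trans hpn
  have hpi := Real.pi_pos
  have hlow : ∑ k ∈ Finset.range n, (1 - lambdaU (fun k : ℕ => ψ k) n p k) * harmonicTerm f k 0
      = 1 / π * ∑ j ∈ Finset.range n, lowCoeff (ψ n) p (j + 1) *
        ∫ u in (-π)..π, φ u * Real.cos ((j + 1 : ℕ) * (-u) + (n * u + β * π / 2)) := by
    rw [← Finset.sum_range_reflect, Finset.mul_sum]
    refine Finset.sum_congr rfl fun j hj => ?_
    have hjn := Finset.mem_range.1 hj
    rcases Nat.eq_zero_or_pos (n - 1 - j) with hk | hk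
    · have h1 : lambdaU (fun k : ℕ => ψ k) n p (n - 1 - j) = 1 := by
        rw [lambdaU, if_pos (by omega)]
      have h2 : lowCoeff (ψ n) p (j + 1) = 0 := by
        have hp0 : (0:ℝ) < p := by exact_mod_cast hp
        have h3 : (p : ℝ) ≤ (j + 1 : ℕ) := by exact_mod_cast (by omega : p ≤ j + 1)
        have h4 : 1 ≤ (0 + ((j + 1 : ℕ) : ℝ)) / p := by rw [le_div_iff₀ hp0]; linarith
        rw [lowCoeff, rampWeight, max_eq_left (by linarith), mul_zero]
      rw [h1, h2]; ring
    · have hcast : ((n - 1 - j : ℕ) : ℝ) = n - (j + 1 : ℕ) := by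
        rw [Nat.sub_sub, add_comm 1 j, Nat.cast_sub (by omega)]
      rw [h.harmonicTerm_zero hk (hpos _ (by exact_mod_cast hk)).ne',
        ← one_sub_lambdaU_mul hpos hp hpn hjn hk]
      have : ∀ u : ℝ, ((n - 1 - j : ℕ) : ℝ) * u + β * π / 2
          = (j + 1 : ℕ) * (-u) + (n * u + β * π / 2) := fun u => by rw [hcast]; ring
      simp only [this]
      ring
  have hhigh : ∑ j ∈ Finset.range (N - n), (1 - ((n + j : ℕ) : ℝ) / N) * harmonicTerm f (n + j) 0
      = 1 / π * ∑ j ∈ Finset.range (N - n), highCoeff ψ n N j *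
        ∫ u in (-π)..π, φ u * Real.cos (j * u + (n * u + β * π / 2)) := by
    rw [Finset.mul_sum]
    refine Finset.sum_congr rfl fun j hj => ?_
    have hjn := Finset.mem_range.1 hj
    have hk : 1 ≤ n + j := by omega
    have hN0 : (0:ℝ) < N := by exact_mod_cast (by omega : 0 < N)
    have hle : ((n : ℝ) + j) / N ≤ 1 :=
      div_le_one_of_le₀ (by exact_mod_cast (by omega : n + j ≤ N)) hN0.le
    rw [h.harmonicTerm_zero hk (hpos _ (by exact_mod_cast hk)).ne', highCoeff, rampWeight,
      max_eq_right (by linarith)]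
    have : ∀ u : ℝ, ((n + j : ℕ) : ℝ) * u + β * π / 2 = j * u + (n * u + β * π / 2) := fun u => by
      push_cast; ring
    simp only [this]
    push_cast
    ring
  have hker : ∀ u : ℝ, φ u * deviationKernel ψ n p N u (n * u + β * π / 2)
      = (∑ j ∈ Finset.range n, lowCoeff (ψ n) p (j + 1) *
          (φ u * Real.cos ((j + 1 : ℕ) * (-u) + (n * u + β * π / 2)))) +
        ∑ j ∈ Finset.range (N - n), highCoeff ψ n N j *
          (φ u * Real.cos (j * u + (n * u + β * π / 2))) := fun u => by
    have h0 : lowCoeff (ψ n) p 0 = ψ n := by simp [lowCoeff, rampWeight]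
    have e0 : ((0 : ℕ) : ℝ) * (-u) + (n * u + β * π / 2) = n * u + β * π / 2 := by simp
    rw [deviationKernel, Finset.sum_range_succ', h0, e0, add_sub_cancel_right, mul_add,
      Finset.mul_sum, Finset.mul_sum]
    congr 1 <;> exact Finset.sum_congr rfl fun j _ => by ring
  have i1 : ∀ j ∈ Finset.range n, IntervalIntegrable (fun u => lowCoeff (ψ n) p (j + 1) *
      (φ u * Real.cos ((j + 1 : ℕ) * (-u) + (n * u + β * π / 2)))) volume (-π) π := fun j _ =>
    (h.1.intervalIntegrable_mul (by fun_prop) _ _).const_mul _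
  have i2 : ∀ j ∈ Finset.range (N - n), IntervalIntegrable (fun u => highCoeff ψ n N j *
      (φ u * Real.cos (j * u + (n * u + β * π / 2)))) volume (-π) π := fun j _ =>
    (h.1.intervalIntegrable_mul (by fun_prop) _ _).const_mul _
  simp only [hker]
  rw [intervalIntegral.integral_add (by simpa only [Finset.sum_fn] using IntervalIntegrable.sum _ i1)
      (by simpa only [Finset.sum_fn] using IntervalIntegrable.sum _ i2),
    intervalIntegral.integral_finsetSum i1, intervalIntegral.integral_finsetSum i2]
  simp only [intervalIntegral.integral_const_mul]
  rw [deviationSum, hlow, hhigh, mul_add]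

theorem continuous_deviationKernel (ψ : ℝ → ℝ) (n p N : ℕ) (θ : ℝ) :
    Continuous fun u => deviationKernel ψ n p N u (n * u + θ) := by
  unfold deviationKernel; fun_prop

theorem measurable_mainKernel (G r s c θ : ℝ) :
    Measurable fun u => mainKernel G r s u (c * u + θ) := by
  unfold mainKernel
  have h : ∀ x y : ℝ, Measurable fun u : ℝ => if x < |u| ∧ |u| < y then (1:ℝ) else 0 := fun x y =>
    Measurable.ite ((measurableSet_lt measurable_const measurable_id.abs).inter
      (measurableSet_lt measurable_id.abs measurable_const)) measurable_const measurable_const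
  exact ((by fun_prop : Measurable fun u : ℝ => G * (Real.sin (c * u + θ) / u))).mul
    ((h r s).sub (h s r))

theorem SInf.abs_integral_sub_le {φ K M B : ℝ → ℝ} (h : SInf φ) (hK : Continuous K)
    (hM : Measurable M) (hB : IntegrableOn B (Icc (-π) π))
    (hKM : ∀ u, |u| ≤ π → |K u - M u| ≤ B u) :
    |(∫ u in (-π)..π, φ u * K u) - ∫ u in Icc (-π) π, φ u * M u| ≤ ∫ u in Icc (-π) π, B u := by
  have hpi := Real.pi_pos
  rw [intervalIntegral.integral_of_le (by linarith), ← integral_Icc_eq_integral_Ioc]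
  have iK : IntegrableOn (fun u => φ u * K u) (Icc (-π) π) := by
    have := h.intervalIntegrable_mul hK (-π) π
    rwa [intervalIntegrable_iff_integrableOn_Icc_of_le (by linarith)] at this
  have hbd : ∀ᵐ u ∂volume.restrict (Icc (-π) π), ‖φ u * (K u - M u)‖ ≤ B u := by
    filter_upwards [ae_restrict_of_ae h.2.2, ae_restrict_mem measurableSet_Icc] with u hu hmem
    rw [Real.norm_eq_abs, abs_mul]
    exact (mul_le_of_le_one_left (abs_nonneg _) hu).trans (hKM u (abs_le.2 hmem))
  have iD : IntegrableOn (fun u => φ u * (K u - M u)) (Icc (-π) π) :=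
    Integrable.mono' hB (h.1.mul (hK.measurable.sub hM)).aestronglyMeasurable hbd
  have iM : IntegrableOn (fun u => φ u * M u) (Icc (-π) π) := by
    have := iK.sub iD
    refine this.congr (ae_of_all _ fun u => ?_)
    simp only [Pi.sub_apply]; ring
  rw [← integral_sub iK iM, ← Real.norm_eq_abs]
  refine norm_integral_le_of_norm_le hB ?_
  simpa only [mul_sub] using hbd

theorem Ioo_neg_union_Ioo {a : ℝ} (ha : 0 ≤ a) (b : ℝ) :
    Ioo (-b) (-a) ∪ Ioo a b = {t | a < |t| ∧ |t| < b} := by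
  ext t
  simp only [mem_union, mem_Ioo, mem_ofPred_eq, lt_abs, abs_lt]
  constructor
  · rintro (⟨h1, h2⟩ | ⟨h1, h2⟩)
    · exact ⟨Or.inr (by linarith), by linarith, by linarith⟩
    · exact ⟨Or.inl h1, by linarith, h2⟩
  · rintro ⟨h1 | h1, h2, h3⟩
    · exact Or.inr ⟨h1, h3⟩
    · exact Or.inl ⟨h2, by linarith⟩

theorem measurableSet_abs_between (a b : ℝ) : MeasurableSet {t : ℝ | a < |t| ∧ |t| < b} :=
  (measurableSet_lt measurable_const measurable_id.abs).inter
    (measurableSet_lt measurable_id.abs measurable_const)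

theorem integral_rescale (φ : ℝ → ℝ) {c a b : ℝ} (hc : 0 < c) (ha : 0 ≤ a) (hb : b ≤ 1) (θ : ℝ) :
    ∫ t in Ioo (-(c * b)) (-(c * a)) ∪ Ioo (c * a) (c * b), φ (t / c) * Real.sin (t + θ) / t
      = ∫ u in Icc (-π) π, φ u * (Real.sin (c * u + θ) / u *
          if a < |u| ∧ |u| < b then 1 else 0) := by
  rw [Ioo_neg_union_Ioo (by positivity), ← integral_indicator (measurableSet_abs_between _ _)]
  have e1 : ({t : ℝ | c * a < |t| ∧ |t| < c * b}.indicator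
        fun t => φ (t / c) * Real.sin (t + θ) / t)
      = fun t => c⁻¹ * (φ (t / c) * (Real.sin (c * (t / c) + θ) / (t / c) *
          if a < |t / c| ∧ |t / c| < b then 1 else 0)) := by
    ext t
    have hiff : (a < |t / c| ∧ |t / c| < b) ↔ (c * a < |t| ∧ |t| < c * b) := by
      rw [abs_div, abs_of_pos hc, lt_div_iff₀' hc, div_lt_iff₀' hc]
    simp only [indicator_apply, mem_ofPred_eq, hiff, mul_div_cancel₀ t hc.ne']
    split_ifs
    · field_simp
    · simp
  rw [e1, integral_const_mul, Measure.integral_comp_div (fun u => φ u *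
    (Real.sin (c * u + θ) / u * if a < |u| ∧ |u| < b then 1 else 0)) c, abs_of_pos hc, smul_eq_mul,
    inv_mul_cancel_left₀ hc.ne']
  refine (setIntegral_eq_integral_of_forall_compl_eq_zero fun u hu => ?_).symm
  rw [if_neg]
  · simp
  · rintro ⟨-, h⟩
    exact hu (abs_le.1 (by linarith [Real.pi_gt_three]))

theorem integral_mul_mainKernel (φ : ℝ → ℝ) (G r s c θ : ℝ) {σ a b : ℝ}
    (h : (σ = 1 ∧ a = r ∧ b = s ∧ r ≤ s) ∨ (σ = -1 ∧ a = s ∧ b = r ∧ s ≤ r)) :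
    ∫ u in Icc (-π) π, φ u * mainKernel G r s u (c * u + θ)
      = σ * G * ∫ u in Icc (-π) π, φ u * (Real.sin (c * u + θ) / u *
          if a < |u| ∧ |u| < b then 1 else 0) := by
  rw [← integral_const_mul]
  congr 1
  ext u
  unfold mainKernel
  rcases h with ⟨rfl, rfl, rfl, hle⟩ | ⟨rfl, rfl, rfl, hle⟩
  · rw [if_neg (c := b < |u| ∧ |u| < a) fun h => (h.1.trans h.2).not_ge hle]; ring
  · rw [if_neg (c := b < |u| ∧ |u| < a) fun h => (h.1.trans h.2).not_ge hle]; ring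

theorem abs_deviation_sub_le {ψ : ℝ → ℝ} (hpos : ∀ t ≥ (1 : ℝ), 0 < ψ t) {C β r s σ a b : ℝ}
    {n p : ℕ} (hp : 1 ≤ p) (hpn : p ≤ n) {f φ : ℝ → ℝ} (hf : Continuous f)
    (h : IsPsiDeriv (fun k : ℕ => ψ k) β f φ)
    (hC : ∀ᶠ N : ℕ in atTop, ∃ B : ℝ → ℝ,
      IntegrableOn B (Icc (-π) π) ∧ ∫ u in Icc (-π) π, B u ≤ C * ψ n ∧
      ∀ u : ℝ, |u| ≤ π → ∀ a : ℝ,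
        |deviationKernel ψ n p N u a - mainKernel (ψ n) r s u a| ≤ B u)
    (ha : 0 ≤ a) (hb : b ≤ 1)
    (hσ : (σ = 1 ∧ a = r ∧ b = s ∧ r ≤ s) ∨ (σ = -1 ∧ a = s ∧ b = r ∧ s ≤ r)) :
    |(f 0 - Usum (fun k : ℕ => ψ k) n p f 0) - σ * (ψ n / π) *
      ∫ t in Ioo (-(n * b)) (-(n * a)) ∪ Ioo (n * a) (n * b),
        φ (t / n) * Real.sin (t + β * π / 2) / t| ≤ C * ψ n := by
  have hpi := Real.pi_pos
  have hn0 : (0:ℝ) < n := by exact_mod_cast hp.trans hpn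
  have hlim := ((tendsto_deviationSum (fun k : ℕ => ψ k) n p hf).sub_const
    (σ * (ψ n / π) * ∫ t in Ioo (-(n * b)) (-(n * a)) ∪ Ioo (n * a) (n * b),
        φ (t / n) * Real.sin (t + β * π / 2) / t)).abs
  refine le_of_tendsto hlim ?_
  filter_upwards [hC] with N hN
  obtain ⟨B, hB, hBC, hker⟩ := hN
  have hle := h.1.abs_integral_sub_le (continuous_deviationKernel ψ n p N (β * π / 2))
    (measurable_mainKernel (ψ n) r s n (β * π / 2)) hB fun u hu => hker u hu _
  rw [integral_mul_mainKernel φ (ψ n) r s n (β * π / 2) hσ] at hle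
  rw [h.deviationSum_eq hpos hp hpn, integral_rescale φ hn0 ha hb]
  have e : ∀ x y : ℝ, 1 / π * x - σ * (ψ n / π) * y = 1 / π * (x - σ * ψ n * y) := fun x y => by
    ring
  rw [e, abs_mul, abs_of_pos (by positivity : 0 < 1 / π)]
  refine le_trans (mul_le_of_le_one_left (abs_nonneg _) ?_) (hle.trans hBC)
  rw [div_le_one hpi]
  linarith [Real.pi_gt_three]

/-- Corollary of Lemma 1: for `ψ ∈ F` there is a constant `C = C(ψ)`
(uniform in `β`, `n`, `p`, `f`) such that for every `f ∈ C^ψ_{β,∞}` with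
`(ψ,β)`-derivative `φf`:
`|ρ_{n,p}(f;0) - (-1)^s (ψ(n)/π) ∫_{I_n} φf(t/n) sin(t+βπ/2)/t dt| ≤ C ψ(n)`,
where `μ(n) = n/(η(ψ;n) - n)`. -/
theorem statement8 (ψ : ℝ → ℝ) (hψ : FClass ψ) :
    ∃ C : ℝ, ∀ (β : ℝ) (n p : ℕ), 1 ≤ p → p ≤ n → ∀ f φf : ℝ → ℝ,
      Continuous f → Periodic2pi f → IsPsiDeriv (fun k : ℕ => ψ k) β f φf →
      |(f 0 - Usum (fun k : ℕ => ψ k) n p f 0) -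
        (if (n : ℝ) / (eta ψ n - n) ≤ (n : ℝ) / p then (-1 : ℝ) else 1) * (ψ n / π) *
          ∫ t in (if (n : ℝ) / (eta ψ n - n) ≤ (n : ℝ) / p then
                    Ioo (-((n : ℝ) / p)) (-((n : ℝ) / (eta ψ n - n))) ∪
                      Ioo ((n : ℝ) / (eta ψ n - n)) ((n : ℝ) / p)
                  else if (n : ℝ) / (eta ψ n - n) ≤ n then
                    Ioo (-((n : ℝ) / (eta ψ n - n))) (-((n : ℝ) / p)) ∪
                      Ioo ((n : ℝ) / p) ((n : ℝ) / (eta ψ n - n))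
                  else
                    Ioo (-(n : ℝ)) (-((n : ℝ) / p)) ∪ Ioo ((n : ℝ) / p) (n : ℝ)),
            φf (t / n) * Real.sin (t + β * π / 2) / t| ≤ C * ψ n := by
  obtain ⟨C, hC⟩ := hψ.exists_deviationKernel_bound
  obtain ⟨_, _, _, _, hgap⟩ := hψ.exists_bounds
  refine ⟨C, fun β n p hp hpn f φf hf _ hφ => ?_⟩
  have hn1 : (1:ℝ) ≤ n := by exact_mod_cast hp.trans hpn
  have hp1 : (1:ℝ) ≤ p := by exact_mod_cast hp
  have hn0 : (0:ℝ) < n := by linarith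
  have hp0 : (0:ℝ) < p := by linarith
  have hh0 := (hgap n (hp.trans hpn)).1
  have hev := hC n p hp hpn
  have hr : 1 / (p : ℝ) ≤ 1 := div_le_one_of_le₀ hp1 hp0.le
  have bound := fun {r s C σ a b : ℝ} => abs_deviation_sub_le (r := r) (s := s) (C := C) (σ := σ) (a := a) (b := b)
    hψ.1.1 hp hpn hf hφ
  simp only [div_le_div_iff_of_pos_left hn0 hh0 hp0, div_le_iff₀ hh0]
  by_cases h1 : (p : ℝ) ≤ eta ψ n - n
  · rw [max_eq_left (hp1.trans h1)] at hev
    simp only [if_pos h1]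
    rw [div_eq_mul_one_div (n : ℝ) (p : ℝ), div_eq_mul_one_div (n : ℝ) (eta ψ n - n)]
    exact bound hev (by positivity) hr
      (Or.inr ⟨rfl, rfl, rfl, one_div_le_one_div_of_le hp0 h1⟩)
  · simp only [if_neg h1]
    by_cases h2 : (n : ℝ) ≤ n * (eta ψ n - n)
    · have h3 : 1 ≤ eta ψ n - n := by
        by_contra hlt
        nlinarith
      rw [max_eq_left h3] at hev
      simp only [if_pos h2]
      rw [div_eq_mul_one_div (n : ℝ) (p : ℝ), div_eq_mul_one_div (n : ℝ) (eta ψ n - n)]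
      exact bound hev (by positivity) (div_le_one_of_le₀ h3 hh0.le)
        (Or.inl ⟨rfl, rfl, rfl, one_div_le_one_div_of_le hh0 (not_le.1 h1).le⟩)
    · have h3 : eta ψ n - n ≤ 1 := by
        by_contra hlt
        exact h2 (by nlinarith)
      rw [max_eq_right h3] at hev
      simp only [if_neg h2]
      have := bound hev (a := 1 / p) (b := 1 / 1) (by positivity) (by norm_num)
        (Or.inl ⟨rfl, rfl, rfl, by simpa using hr⟩)
      rw [div_one, mul_one, ← div_eq_mul_one_div] at this
      exact this
end
end

section
/- Let ψ : [1, ∞) → ℝ be continuously differentiable, nonincreasing, with lim_{u→∞} ψ(u) = 0, let n, p ∈ ℕ with 1 ≤ p ≤ n, and define τ_{n,p}(u) = 0 for 0 ≤ u ≤ (n−p)/n, τ_{n,p}(u) = ψ(n)·(nu − n + p)/p for (n−p)/n ≤ u ≤ 1, and τ_{n,p}(u) = ψ(nu) for u ≥ 1. Then for every real t ≠ 0, the improper integral τ̂_{n,p+}(t) = (1/π)∫_0^∞ τ_{n,p}(u) cos(ut) du converges and τ̂_{n,p+}(t) = (ψ(n)/(π t²))·(n/p)·(cos t − cos((n−p)t/n))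 − (n/(π t))·∫_1^∞ ψ'(nu) sin(ut) du. -/
open Real Filter Set intervalIntegral

/-- The kernel `τ_{n,p}`: `0` on `[0, (n-p)/n]`, the ramp `ψ(n)(nu-n+p)/p` on
`[(n-p)/n, 1]`, and `ψ(nu)` for `u ≥ 1`. -/
noncomputable def tauKernel (ψ : ℝ → ℝ) (n p : ℕ) (u : ℝ) : ℝ :=
  if u ≤ ((n : ℝ) - p) / n then 0
  else if u ≤ 1 then ψ n * ((n : ℝ) * u - n + p) / p
  else ψ (n * u)

theorem hasDerivAt_sin_mul_const (t x : ℝ) :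
    HasDerivAt (fun u => Real.sin (u * t)) (t * Real.cos (x * t)) x := by
  simpa [mul_comm] using ((hasDerivAt_id x).mul_const t).sin

/-- Integration by parts against `cos (u * t)`, with differentiability required only in the
interior of the interval. -/
theorem integral_mul_cos_eq_sub {g g' : ℝ → ℝ} {a b t : ℝ} (hab : a ≤ b) (ht : t ≠ 0)
    (hg : ContinuousOn g (Icc a b)) (hg' : ∀ x ∈ Ioo a b, HasDerivAt g (g' x) x)
    (hderiv_int : IntervalIntegrable g' MeasureTheory.volume a b) :
    ∫ u in a..b, g u * Real.cos (u * t) =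
      (g b * Real.sin (b * t) - g a * Real.sin (a * t)) / t
        - 1 / t * ∫ u in a..b, g' u * Real.sin (u * t) := by
  have hsin : IntervalIntegrable (fun u => g' u * Real.sin (u * t)) MeasureTheory.volume a b :=
    hderiv_int.mul_continuousOn (by fun_prop)
  have hcos : IntervalIntegrable (fun u => g u * Real.cos (u * t)) MeasureTheory.volume a b :=
    ContinuousOn.intervalIntegrable (by rw [uIcc_of_le hab]; fun_prop)
  have ftc := integral_eq_sub_of_hasDerivAt_of_le hab
    (f := fun u => g u * Real.sin (u * t))
    (f' := fun u => g' u * Real.sin (u * t) + t * (g u * Real.cos (u * t))) (by fun_prop)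
    (fun x hx => ((hg' x hx).mul (hasDerivAt_sin_mul_const t x)).congr_deriv (by ring))
    (hsin.add (hcos.const_mul t))
  rw [intervalIntegral.integral_add hsin (hcos.const_mul t),
    intervalIntegral.integral_const_mul] at ftc
  refine mul_left_cancel₀ ht ?_
  rw [mul_sub, mul_div_cancel₀ _ ht, ← mul_assoc, mul_one_div_cancel ht, one_mul]
  linarith

theorem integral_ramp_mul_cos {c d a b t : ℝ} (hab : a ≤ b) (ht : t ≠ 0) :
    ∫ u in a..b, (c * u + d) * Real.cos (u * t) =
      ((c * b + d) * Real.sin (b * t) - (c * a + d) * Real.sin (a * t)) / t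
        + c / t ^ 2 * (Real.cos (b * t) - Real.cos (a * t)) := by
  have hsin : ∫ u in a..b, Real.sin (u * t) = (Real.cos (a * t) - Real.cos (b * t)) / t := by
    rw [intervalIntegral.integral_comp_mul_right Real.sin ht, integral_sin, smul_eq_mul]
    field_simp
  rw [integral_mul_cos_eq_sub (g' := fun _ => c) hab ht (by fun_prop)
    (fun x _ => by simpa using ((hasDerivAt_id x).const_mul c).add_const d) (by simp),
    intervalIntegral.integral_const_mul, hsin]
  field_simp
  ring

/-- if `ψ : [1,∞) → ℝ` is continuously differentiable, nonincreasing and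
vanishing at infinity, and `1 ≤ p ≤ n`, then for every real `t ≠ 0` the improper integral
`τ̂_{n,p+}(t) = (1/π)∫_0^∞ τ_{n,p}(u) cos(ut) du` converges and equals
`(ψ(n)/(πt²))(n/p)(cos t - cos((n-p)t/n)) - (n/(πt)) ∫_1^∞ ψ'(nu) sin(ut) du`. -/
theorem statement13 (ψ : ℝ → ℝ) (h₁ : ContDiffOn ℝ 1 ψ (Set.Ici 1))
    (h₂ : AntitoneOn ψ (Set.Ici 1)) (h₃ : Tendsto ψ atTop (nhds 0))
    (n p : ℕ) (hp : 1 ≤ p) (hpn : p ≤ n) :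
    ∀ t : ℝ, t ≠ 0 →
      ∃ L L' : ℝ,
        Tendsto (fun A : ℝ => ∫ u in (0 : ℝ)..A, tauKernel ψ n p u * Real.cos (u * t))
          atTop (nhds L) ∧
        Tendsto (fun A : ℝ => ∫ u in (1 : ℝ)..A, deriv ψ (n * u) * Real.sin (u * t))
          atTop (nhds L') ∧
        1 / π * L = ψ n / (π * t ^ 2) * ((n : ℝ) / p) *
            (Real.cos t - Real.cos (((n : ℝ) - p) * t / n)) - n / (π * t) * L' := by
  intro t ht
  have hn : (1 : ℝ) ≤ n := by exact_mod_cast hp.trans hpn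
  have hn0 : (0 : ℝ) < n := by linarith
  have hp0 : (0 : ℝ) < p := by exact_mod_cast hp
  have hpn' : (p : ℝ) ≤ n := by exact_mod_cast hpn
  set a : ℝ := ((n : ℝ) - p) / n with ha
  have ha0 : 0 ≤ a := div_nonneg (by linarith) hn0.le
  have ha1 : a ≤ 1 := by rw [ha, div_le_one hn0]; linarith
  have hmaps : MapsTo (fun u : ℝ => (n : ℝ) * u) (Ici 1) (Ici 1) := fun u hu => by
    have : (1 : ℝ) ≤ u := hu
    show (1 : ℝ) ≤ n * u
    nlinarith
  have hcont : ContinuousOn (fun u : ℝ => ψ (n * u)) (Ici 1) :=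
    h₁.continuousOn.comp (by fun_prop) hmaps
  have hnhds : ∀ u ∈ Ioi (1 : ℝ), Ici (1 : ℝ) ∈ nhds ((n : ℝ) * u) := fun u hu => by
    have : (1 : ℝ) < u := hu
    exact Ici_mem_nhds (by nlinarith)
  have hderiv : ∀ u ∈ Ioi (1 : ℝ),
      HasDerivAt (fun u : ℝ => ψ (n * u)) (n * deriv ψ (n * u)) u := fun u hu => by
    have h := (((h₁.differentiableOn one_ne_zero).differentiableAt (hnhds u hu)).hasDerivAt).comp u
      ((hasDerivAt_id u).const_mul (n : ℝ))
    exact h.congr_deriv (by ring)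
  have hneg : ∀ u ∈ Ioi (1 : ℝ), (n : ℝ) * deriv ψ (n * u) ≤ 0 := fun u hu => by
    rw [← derivWithin_of_mem_nhds (hnhds u hu)]
    exact mul_nonpos_of_nonneg_of_nonpos hn0.le h₂.derivWithin_nonpos
  have hlim : Tendsto (fun u : ℝ => ψ (n * u)) atTop (nhds 0) :=
    h₃.comp (tendsto_id.const_mul_atTop hn0)
  have hderiv_int : MeasureTheory.IntegrableOn (fun u : ℝ => n * deriv ψ (n * u)) (Ioi 1) :=
    MeasureTheory.integrableOn_Ioi_deriv_of_nonpos (hcont 1 self_mem_Ici) hderiv hneg hlim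
  have hderiv_sin_int : MeasureTheory.IntegrableOn
      (fun u : ℝ => deriv ψ (n * u) * Real.sin (u * t)) (Ioi 1) := by
    have h : MeasureTheory.IntegrableOn (fun u : ℝ => deriv ψ (n * u)) (Ioi 1) := by
      refine (MeasureTheory.Integrable.const_mul hderiv_int (n : ℝ)⁻¹).congr (.of_forall fun u => ?_)
      exact inv_mul_cancel_left₀ hn0.ne' _
    exact h.mul_bdd (c := 1) (by fun_prop)
      (.of_forall fun u => by simpa using Real.abs_sin_le_one (u * t))
  have hL' := MeasureTheory.intervalIntegral_tendsto_integral_Ioi 1 hderiv_sin_int tendsto_id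
  set L' : ℝ := ∫ u in Ioi (1 : ℝ), deriv ψ (n * u) * Real.sin (u * t)
  have htail : ∀ A : ℝ, 1 ≤ A → ∫ u in (1 : ℝ)..A, ψ (n * u) * Real.cos (u * t) =
      (ψ (n * A) * Real.sin (A * t) - ψ n * Real.sin t) / t
        - n / t * ∫ u in (1 : ℝ)..A, deriv ψ (n * u) * Real.sin (u * t) := fun A hA => by
    rw [integral_mul_cos_eq_sub (g := fun u => ψ (n * u)) (g' := fun u => n * deriv ψ (n * u))
      hA ht (hcont.mono Icc_subset_Ici_self) (fun x hx => hderiv x hx.1)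
      ((intervalIntegrable_iff_integrableOn_Ioc_of_le hA).2 (hderiv_int.mono_set Ioc_subset_Ioi_self))]
    simp only [mul_assoc, intervalIntegral.integral_const_mul, mul_one, one_mul]
    ring
  have htail_lim : Tendsto (fun A : ℝ => ∫ u in (1 : ℝ)..A, ψ (n * u) * Real.cos (u * t)) atTop
      (nhds ((0 - ψ n * Real.sin t) / t - n / t * L')) := by
    have hbdry : Tendsto (fun A : ℝ => ψ (n * A) * Real.sin (A * t)) atTop (nhds 0) :=
      hlim.zero_mul_isBoundedUnder_le
        (isBoundedUnder_of ⟨1, fun A => by simpa using Real.abs_sin_le_one (A * t)⟩)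
    refine (((hbdry.sub_const _).div_const t).sub (hL'.const_mul (n / t))).congr' ?_
    filter_upwards [eventually_ge_atTop 1] with A hA using (htail A hA).symm
  have hzero_eq : EqOn (fun _ => 0) (fun u => tauKernel ψ n p u * Real.cos (u * t)) (Ioo 0 a) :=
    fun u hu => by
      have : u ≤ ((n : ℝ) - p) / n := hu.2.le
      simp [tauKernel, this]
  have hramp_eq : EqOn (fun u => (ψ n * n / p * u + ψ n * (p - n) / p) * Real.cos (u * t))
      (fun u => tauKernel ψ n p u * Real.cos (u * t)) (Ioo a 1) := fun u hu => by
    have : ¬ u ≤ ((n : ℝ) - p) / n := not_le.2 hu.1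
    simp only [tauKernel, this, hu.2.le, if_true, if_false]
    ring
  have htail_eq : ∀ A : ℝ, EqOn (fun u => ψ (n * u) * Real.cos (u * t))
      (fun u => tauKernel ψ n p u * Real.cos (u * t)) (Ioo 1 A) := fun A u hu => by
    have h : ¬ u ≤ ((n : ℝ) - p) / n := not_le.2 (ha1.trans_lt hu.1)
    simp [tauKernel, h, not_le.2 hu.1]
  have hsplit : ∀ A : ℝ, 1 ≤ A →
      ∫ u in (0 : ℝ)..A, tauKernel ψ n p u * Real.cos (u * t) =
        ψ n * Real.sin t / t + ψ n * n / p / t ^ 2 * (Real.cos t - Real.cos (a * t))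
          + ∫ u in (1 : ℝ)..A, ψ (n * u) * Real.cos (u * t) := fun A hA => by
    have hi0 : IntervalIntegrable (fun u => tauKernel ψ n p u * Real.cos (u * t))
        MeasureTheory.volume 0 a :=
      IntervalIntegrable.congr_uIoo (f := fun _ => (0 : ℝ)) (by simp)
        (by rw [uIoo_of_le ha0]; exact hzero_eq)
    have hi1 : IntervalIntegrable (fun u => tauKernel ψ n p u * Real.cos (u * t))
        MeasureTheory.volume a 1 :=
      IntervalIntegrable.congr_uIoo
        (f := fun u => (ψ n * n / p * u + ψ n * (p - n) / p) * Real.cos (u * t))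
        (Continuous.intervalIntegrable (by fun_prop) _ _)
        (by rw [uIoo_of_le ha1]; exact hramp_eq)
    have hiA : IntervalIntegrable (fun u => tauKernel ψ n p u * Real.cos (u * t))
        MeasureTheory.volume 1 A := by
      refine IntervalIntegrable.congr_uIoo (ContinuousOn.intervalIntegrable ?_)
        (by rw [uIoo_of_le hA]; exact htail_eq A)
      rw [uIcc_of_le hA]
      exact (hcont.mono Icc_subset_Ici_self).mul (by fun_prop)
    rw [← integral_add_adjacent_intervals (hi0.trans hi1) hiA,
      ← integral_add_adjacent_intervals hi0 hi1,
      ← integral_congr_Ioo_of_le ha0 hzero_eq, ← integral_congr_Ioo_of_le ha1 hramp_eq,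
      ← integral_congr_Ioo_of_le hA (htail_eq A), integral_ramp_mul_cos ha1 ht]
    have hva : ψ n * n / p * a + ψ n * (p - n) / p = 0 := by rw [ha]; field_simp; ring
    have hv1 : ψ n * n / p * 1 + ψ n * (p - n) / p = ψ n := by field_simp; ring
    rw [hva, hv1]
    simp
  refine ⟨_, L', (htail_lim.const_add
    (ψ n * Real.sin t / t + ψ n * n / p / t ^ 2 * (Real.cos t - Real.cos (a * t)))).congr' ?_,
    hL', ?_⟩
  · filter_upwards [eventually_ge_atTop 1] with A hA using (hsplit A hA).symm
  · rw [show ((n : ℝ) - p) * t / n = a * t by rw [ha]; ring]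
    field_simp
    ring
end
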